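/- arXiv:1302.5651 — 3 statements merged into one kernel-verified Lean document; each statement's English description precedes it below -/
import Mathlib

section
/- Let K be a tame family of compact subsets of a strongly locally homogeneous completely metrizable space X. Then any two dense K-tame decompositions A, B of X are topologically equivalent. Moreover, for any open cover U of X there is a homeomorphism Φ : X → X such that Φ(A) = B and (Φ, id_X) ≺ W, where W = {St(A,U) ∪ St(B,U) : A ∈ A, B ∈ B, St(A,U) ∩ St(B,U) ≠ ∅} and St(A,U) denotes the union of all members of U meeting A. -/
open Set Topology unitInterval

noncomputable section

/-! ### General notions -/

/-- `X` is completely metrizable: its topology is generated by a complete metric. -/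
def CompletelyMetrizable (X : Type*) [t : TopologicalSpace X] : Prop :=
  ∃ m : MetricSpace X, m.toUniformSpace.toTopologicalSpace = t ∧
    @CompleteSpace X m.toUniformSpace

/-- The model cube `I^n` for `n ≤ ω`: `some k` codes the finite cube `I^k`,
`none` codes the Hilbert cube `I^ω`. -/
def ModelCube : Option ℕ → Type
  | some k => Fin k → unitInterval
  | none => ℕ → unitInterval

instance : (n : Option ℕ) → TopologicalSpace (ModelCube n)
  | some k => inferInstanceAs (TopologicalSpace (Fin k → unitInterval))
  | none => inferInstanceAs (TopologicalSpace (ℕ → unitInterval))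

/-- A manifold modeled on `E`: a paracompact space each point of which has an open
neighborhood homeomorphic to an open subset of `E`. -/
def IsManifoldModeledOn (M : Type*) [TopologicalSpace M] (E : Type*) [TopologicalSpace E] :
    Prop :=
  ParacompactSpace M ∧
    ∀ x : M, ∃ O : Set M, IsOpen O ∧ x ∈ O ∧ ∃ U : Set E, IsOpen U ∧ Nonempty (↥O ≃ₜ ↥U)

/-- The pair `(X, A)` is homeomorphic to the pair `(Y, B)`. -/
def PairHomeo {X Y : Type*} [TopologicalSpace X] [TopologicalSpace Y]
    (A : Set X) (B : Set Y) : Prop :=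
  ∃ e : X ≃ₜ Y, ⇑e '' A = B

/-- The cube `I^n` sitting inside `ℝ^n`. -/
def stdCube (n : ℕ) : Set (Fin n → ℝ) := {f | ∀ i, f i ∈ Icc (0 : ℝ) 1}

/-- The copy of `I^ω × [0,1]` sitting inside `I^ω × [0,2)`. -/
def hilbertCollar : Set ((ℕ → unitInterval) × ↥(Ico (0 : ℝ) 2)) := {p | (p.2 : ℝ) ≤ 1}

/-- The Hilbert cube `I^ω`. -/
abbrev HilbertCube : Type := ℕ → unitInterval

/-- The space `I^ω × [0,1)`. -/
abbrev HilbertHalfOpen : Type := HilbertCube × ↥(Ico (0 : ℝ) 1)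

/-- `B` is a tame ball in the `I^n`-manifold `M`: it has an open neighborhood `O` such
that the pair `(O, B)` is homeomorphic to `(ℝ^n, I^n)` (for finite `n`), resp. to
`(I^ω × [0,2), I^ω × [0,1])` (for `n = ω`). -/
def IsTameBall (n : Option ℕ) {M : Type*} [TopologicalSpace M] (B : Set M) : Prop :=
  ∃ O : Set M, IsOpen O ∧ B ⊆ O ∧
    match n with
    | some k => PairHomeo {x : ↥O | (x : M) ∈ B} (stdCube k)
    | none => PairHomeo {x : ↥O | (x : M) ∈ B} hilbertCollar

/-- The family of all tame balls of the `I^n`-manifold `X`. -/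
def tameBalls (n : Option ℕ) (X : Type*) [TopologicalSpace X] : Set (Set X) :=
  {B | IsTameBall n B}

/-- A family of subsets of `X` is vanishing if for any open cover `𝒰` of `X` the subfamily
of sets contained in no member of `𝒰` is locally finite in `X`. -/
def VanishingFamily {X : Type*} [TopologicalSpace X] (F : Set (Set X)) : Prop :=
  ∀ 𝒰 : Set (Set X), (∀ u ∈ 𝒰, IsOpen u) → ⋃₀ 𝒰 = univ →
    LocallyFinite (fun A : {A : Set X // A ∈ F ∧ ∀ u ∈ 𝒰, ¬ A ⊆ u} => (A : Set X))

/-- The family of connected components of the complement of `S`. -/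
def complComponents {X : Type*} [TopologicalSpace X] (S : Set X) : Set (Set X) :=
  {C | ∃ x ∈ Sᶜ, C = connectedComponentIn Sᶜ x}

/-- A spongy subset of an `I^n`-manifold. -/
def IsSpongy (n : Option ℕ) {M : Type*} [TopologicalSpace M] (S : Set M) : Prop :=
  IsClosed S ∧ IsNowhereDense S ∧
  VanishingFamily (complComponents S) ∧
  (∀ C ∈ complComponents S, ∀ C' ∈ complComponents S, C ≠ C' →
    closure C ∩ closure C' = ∅) ∧
  ∀ C ∈ complComponents S, IsTameBall n (closure C)

/-- `S` is a universal nowhere dense subset of `M`. -/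
def UniversalNowhereDense {M : Type*} [TopologicalSpace M] (S : Set M) : Prop :=
  IsNowhereDense S ∧ ∀ A : Set M, IsNowhereDense A → ∃ h : M ≃ₜ M, ⇑h '' A ⊆ S

/-- `(f, g) ≺ 𝒜` : for each `z` with `f z ≠ g z` the doubleton `{f z, g z}` lies in some
member of `𝒜`. -/
def Near {Z X : Type*} (f g : Z → X) (𝒜 : Set (Set X)) : Prop :=
  ∀ z : Z, f z ≠ g z → ∃ A ∈ 𝒜, f z ∈ A ∧ g z ∈ A

/-- The star `St(A, 𝒰)` of a set `A` with respect to a family `𝒰`. -/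
def covStar {X : Type*} (A : Set X) (𝒰 : Set (Set X)) : Set X :=
  ⋃₀ {u ∈ 𝒰 | (u ∩ A).Nonempty}

/-- A compact set `K ⊆ X` is locally shrinkable if for each open neighborhood `O` of `K`
and each open cover `𝒱` of `O` there is a homeomorphism of `X` supported in `O` moving `K`
into a member of `𝒱`. -/
def LocallyShrinkable {X : Type*} [TopologicalSpace X] (K : Set X) : Prop :=
  ∀ O : Set X, IsOpen O → K ⊆ O →
    ∀ 𝒱 : Set (Set X), (∀ v ∈ 𝒱, IsOpen v ∧ v ⊆ O) → O ⊆ ⋃₀ 𝒱 →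
      ∃ h : X ≃ₜ X, (∀ x ∉ O, h x = x) ∧ ∃ v ∈ 𝒱, ⇑h '' K ⊆ v

/-- A family of sets is ambiently invariant if it is invariant under images of
homeomorphisms of the ambient space. -/
def AmbientlyInvariant {X : Type*} [TopologicalSpace X] (𝒦 : Set (Set X)) : Prop :=
  ∀ h : X ≃ₜ X, ∀ K ∈ 𝒦, ⇑h '' K ∈ 𝒦

/-- The local shift property of a family of sets. -/
def LocalShiftProperty {X : Type*} [TopologicalSpace X] (𝒦 : Set (Set X)) : Prop :=
  ∀ x : X, ∀ O ∈ 𝓝 x, ∃ U ∈ 𝓝 x, U ⊆ O ∧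
    ∀ A ∈ 𝒦, ∀ B ∈ 𝒦, A ⊆ U → B ⊆ U →
      ∃ h : X ≃ₜ X, ⇑h '' A = B ∧ ∀ y ∉ O, h y = y

/-- A tame family of compact subsets of `X`. -/
def IsTameFamily {X : Type*} [TopologicalSpace X] (𝒦 : Set (Set X)) : Prop :=
  (∀ K ∈ 𝒦, IsCompact K) ∧ AmbientlyInvariant 𝒦 ∧ (∀ K ∈ 𝒦, LocallyShrinkable K) ∧
    LocalShiftProperty 𝒦 ∧ ∀ U : Set X, IsOpen U → U.Nonempty → ∃ K ∈ 𝒦, K ⊆ U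

/-- `X` is strongly locally homogeneous. -/
def StronglyLocallyHomogeneous (X : Type*) [TopologicalSpace X] : Prop :=
  ∀ x : X, ∀ O ∈ 𝓝 x, ∃ U ∈ 𝓝 x, U ⊆ O ∧
    ∀ y ∈ U, ∃ h : X ≃ₜ X, h x = y ∧ ∀ z ∉ O, h z = z

/-- `X` is topologically homogeneous. -/
def TopologicallyHomogeneous (X : Type*) [TopologicalSpace X] : Prop :=
  ∀ x y : X, ∃ h : X ≃ₜ X, h x = y

/-- `A` is σ-discrete in `X`: a countable union of closed discrete subsets of `X`. -/
def SigmaDiscrete {X : Type*} [TopologicalSpace X] (A : Set X) : Prop :=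
  ∃ f : ℕ → Set X, A = ⋃ n, f n ∧ ∀ n, IsClosed (f n) ∧ DiscreteTopology ↥(f n)

/-! ### Decompositions -/

/-- A decomposition of a topological space `X`: a cover of `X` by pairwise disjoint
nonempty compact subsets. -/
structure Decomposition (X : Type*) [TopologicalSpace X] where
  pieces : Set (Set X)
  nonempty' : ∀ A ∈ pieces, A.Nonempty
  isCompact' : ∀ A ∈ pieces, IsCompact A
  disjoint' : ∀ A ∈ pieces, ∀ B ∈ pieces, A ≠ B → Disjoint A B
  covers : ∀ x : X, ∃ A ∈ pieces, x ∈ A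

namespace Decomposition

variable {X : Type*} [TopologicalSpace X] (D : Decomposition X)

/-- The decomposition space `X/D` (as a set it is the set of pieces). -/
def Space : Type _ := {A : Set X // A ∈ D.pieces}

/-- The quotient map `q_D : X → X/D`. -/
noncomputable def q (x : X) : D.Space := ⟨(D.covers x).choose, (D.covers x).choose_spec.1⟩

/-- The quotient topology on the decomposition space. -/
instance : TopologicalSpace D.Space := TopologicalSpace.coinduced D.q inferInstance

/-- The non-degeneracy part `D°` of a decomposition, viewed inside the decomposition
space. -/
def nondeg : Set D.Space := {A | ¬ (A.1 : Set X).Subsingleton}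

/-- The union of the non-degenerate pieces of a decomposition. -/
def nondegUnion : Set X := ⋃₀ {A ∈ D.pieces | ¬ A.Subsingleton}

/-- A `D`-saturated subset of `X`. -/
def Saturated (U : Set X) : Prop := ∀ A ∈ D.pieces, (A ∩ U).Nonempty → A ⊆ U

/-- A decomposition is upper semicontinuous if saturations of closed sets are closed. -/
def IsUSC : Prop :=
  ∀ F : Set X, IsClosed F → IsClosed (⋃₀ {A ∈ D.pieces | (A ∩ F).Nonempty})

/-- A decomposition is vanishing if for every open cover `𝒰` of `X` the family of pieces
contained in no member of `𝒰` is discrete in `X`. -/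
def Vanishing : Prop :=
  ∀ 𝒰 : Set (Set X), (∀ u ∈ 𝒰, IsOpen u) → ⋃₀ 𝒰 = univ →
    ∀ x : X, ∃ V ∈ 𝓝 x, ∀ A ∈ D.pieces, (∀ u ∈ 𝒰, ¬ A ⊆ u) →
      ∀ B ∈ D.pieces, (∀ u ∈ 𝒰, ¬ B ⊆ u) →
        (V ∩ A).Nonempty → (V ∩ B).Nonempty → A = B

/-- The restriction of `D` to a (`D`-saturated open) set `U` is shrinkable: for each
`D`-saturated open cover `𝒰` of `U` and each open cover `𝒱` of `U` there is a
homeomorphism `h` of the subspace `U` with `(h, id) ≺ 𝒰` and `{h(A) : A ∈ D, A ⊆ U} ≺ 𝒱`. -/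
def ShrinkableOn (U : Set X) : Prop :=
  ∀ 𝒰 : Set (Set X),
    (∀ u ∈ 𝒰, IsOpen u ∧ u ⊆ U ∧ ∀ A ∈ D.pieces, A ⊆ U → (A ∩ u).Nonempty → A ⊆ u) →
    U ⊆ ⋃₀ 𝒰 →
    ∀ 𝒱 : Set (Set X), (∀ v ∈ 𝒱, IsOpen v ∧ v ⊆ U) → U ⊆ ⋃₀ 𝒱 →
      ∃ h : ↥U ≃ₜ ↥U,
        Near (fun x : ↥U => (h x : X)) (fun x : ↥U => (x : X)) 𝒰 ∧
        ∀ A ∈ D.pieces, A ⊆ U →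
          ∃ v ∈ 𝒱, (fun x : ↥U => (x : X)) '' (⇑h '' {x : ↥U | (x : X) ∈ A}) ⊆ v

/-- A decomposition is strongly shrinkable if its restriction to any `D`-saturated open
set is shrinkable. -/
def StronglyShrinkable : Prop :=
  ∀ U : Set X, IsOpen U → D.Saturated U → D.ShrinkableOn U

/-- A decomposition is `𝒦`-tame if it is vanishing, strongly shrinkable, and all its
non-degenerate pieces belong to `𝒦`. -/
def KTame (𝒦 : Set (Set X)) : Prop :=
  D.Vanishing ∧ D.StronglyShrinkable ∧ ∀ A ∈ D.pieces, ¬ A.Subsingleton → A ∈ 𝒦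

/-- A decomposition is dense if its non-degeneracy part is dense in the decomposition
space. -/
def IsDenseDecomp : Prop := Dense D.nondeg

/-- A decomposition is discrete if its non-degeneracy part is closed and discrete in
the decomposition space. -/
def IsDiscreteDecomp : Prop := IsClosed D.nondeg ∧ DiscreteTopology ↥D.nondeg

end Decomposition

/-- A homeomorphism `φ : X/A → X/B` is `(A,B)`-liftable if it lifts to a homeomorphism
`Φ : X → X` with `q_B ∘ Φ = φ ∘ q_A`. -/
def Liftable {X : Type*} [TopologicalSpace X] (A B : Decomposition X)
    (φ : A.Space ≃ₜ B.Space) : Prop :=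
  ∃ Φ : X ≃ₜ X, ∀ x : X, B.q (Φ x) = φ (A.q x)

/-- Two decompositions of `X` are topologically equivalent if some homeomorphism of `X`
maps the first family of pieces onto the second. -/
def TopEquivDecomp {X : Type*} [TopologicalSpace X] (A B : Decomposition X) : Prop :=
  ∃ Φ : X ≃ₜ X, (fun S : Set X => ⇑Φ '' S) '' A.pieces = B.pieces

/-- A `𝒦`-spongy subset of `X`. -/
def IsKSpongy {X : Type*} [TopologicalSpace X] (𝒦 : Set (Set X)) (S : Set X) : Prop :=
  ∃ D : Decomposition X, D.KTame 𝒦 ∧ D.IsDenseDecomp ∧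
    Sᶜ = ⋃ A ∈ D.pieces, interior A

/-! ### Shape notions -/

/-- `K` is point-like in `X`. -/
def PointLike {X : Type*} [TopologicalSpace X] (K : Set X) : Prop :=
  ∀ N : Set X, IsClosed N → K ⊆ interior N →
    ∃ x ∈ interior N, Nonempty (↥(N \ K) ≃ₜ ↥(N \ {x}))

/-- `K` is contractible in `U`: the inclusion `K ↪ U` is homotopic to a constant map. -/
def ContractibleIn {X : Type*} [TopologicalSpace X] (K U : Set X) : Prop :=
  ∃ hKU : K ⊆ U, ∃ y : ↥U,
    (ContinuousMap.mk (Set.inclusion hKU) (continuous_inclusion hKU)).Homotopic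
      (ContinuousMap.const ↥K y)

/-- `K` is cell-like in `X`: `K` is contractible in each of its neighborhoods. -/
def CellLike {X : Type*} [TopologicalSpace X] (K : Set X) : Prop :=
  ∀ U : Set X, IsOpen U → K ⊆ U → ContractibleIn K U

/-- `K` is cellular (with model `E`): every neighborhood of `K` contains a neighborhood
of `K` homeomorphic to `E`. -/
def CellularIn (E : Type*) [TopologicalSpace E] {X : Type*} [TopologicalSpace X]
    (K : Set X) : Prop :=
  ∀ U : Set X, IsOpen U → K ⊆ U → ∃ V ∈ 𝓝ˢ K, V ⊆ U ∧ Nonempty (↥V ≃ₜ E)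

/-- `X` is locally contractible. -/
def LocallyContractible (X : Type*) [TopologicalSpace X] : Prop :=
  ∀ x : X, ∀ U ∈ 𝓝 x, ∃ V ∈ 𝓝 x, V ⊆ U ∧ ContractibleIn V U


/-- `a` has diameter at most `δ`. -/
def SmallSet {X : Type*} [MetricSpace X] (δ : ℝ) (a : Set X) : Prop :=
  ∀ x ∈ a, ∀ y ∈ a, dist x y ≤ δ

/-- An indexed family of sets is discrete: every point has a neighborhood meeting at most
one member of the family. -/
def DiscreteFamily {X ι : Type*} [TopologicalSpace X] (F : ι → Set X) : Prop :=
  ∀ x : X, ∃ V ∈ 𝓝 x, ∀ i j, (V ∩ F i).Nonempty → (V ∩ F j).Nonempty → i = j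

theorem DiscreteFamily.eq_of_mem {X ι : Type*} [TopologicalSpace X] {F : ι → Set X}
    (hF : DiscreteFamily F) {x : X} {i j : ι} (hi : x ∈ F i) (hj : x ∈ F j) : i = j := by
  obtain ⟨V, hV, h⟩ := hF x
  exact h i j ⟨x, mem_of_mem_nhds hV, hi⟩ ⟨x, mem_of_mem_nhds hV, hj⟩

theorem DiscreteFamily.isClosed_iUnion {X ι : Type*} [TopologicalSpace X] {F : ι → Set X}
    (hF : DiscreteFamily F) (hc : ∀ i, IsClosed (F i)) : IsClosed (⋃ i, F i) := by
  refine LocallyFinite.isClosed_iUnion (fun x => ?_) hc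
  obtain ⟨V, hV, h⟩ := hF x
  refine ⟨V, hV, Set.Subsingleton.finite fun i hi j hj => h i j ?_ ?_⟩
  · rwa [inter_comm]
  · rwa [inter_comm]

/-- In a metric space a discrete family expands to a discrete family of open sets lying in
prescribed neighborhoods. -/
theorem DiscreteFamily.exists_open_expansion {X ι : Type*} [MetricSpace X] {F : ι → Set X}
    (hF : DiscreteFamily F) {N : ι → Set X} (hN : ∀ i, IsOpen (N i)) (hFN : ∀ i, F i ⊆ N i) :
    ∃ E : ι → Set X, (∀ i, IsOpen (E i)) ∧ (∀ i, F i ⊆ E i) ∧ (∀ i, E i ⊆ N i) ∧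
      DiscreteFamily E := by
  have : ∀ x : X, ∃ r > 0, ∀ i j, (Metric.ball x r ∩ F i).Nonempty →
      (Metric.ball x r ∩ F j).Nonempty → i = j := by
    intro x
    obtain ⟨V, hV, h⟩ := hF x
    obtain ⟨r, hr, hrV⟩ := Metric.mem_nhds_iff.1 hV
    exact ⟨r, hr, fun i j hi hj => h i j (hi.mono (inter_subset_inter_left _ hrV))
      (hj.mono (inter_subset_inter_left _ hrV))⟩
  choose r hr h using this
  refine ⟨fun i => N i ∩ ⋃ x ∈ F i, Metric.ball x (r x / 4), fun i => ?_, fun i x hx => ?_,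
    fun i => inter_subset_left, fun y => ?_⟩
  · exact (hN i).inter (isOpen_biUnion fun x _ => Metric.isOpen_ball)
  · exact ⟨hFN i hx, mem_biUnion hx (Metric.mem_ball_self (by linarith [hr x]))⟩
  · refine ⟨Metric.ball y (r y / 2), Metric.ball_mem_nhds _ (by linarith [hr y]), ?_⟩
    have key : ∀ i j x x' p q, x ∈ F i → x' ∈ F j → dist p x < r x / 4 →
        dist q x' < r x' / 4 → dist p y < r y / 2 → dist q y < r y / 2 → r x' ≤ r x →
        i = j := by
      intro i j x x' p q hx hx' hp hq hpy hqy hle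
      have t1 : dist x' x ≤ dist q x' + dist q y + dist p y + dist p x := by
        have a1 := dist_triangle x' q x
        have a2 := dist_triangle q y x
        have a3 := dist_triangle y p x
        rw [dist_comm x' q] at a1
        rw [dist_comm y p] at a3
        linarith
      by_cases hc : 2 * r y ≤ r x
      · refine h x i j ⟨x, Metric.mem_ball_self (hr x), hx⟩ ⟨x', ?_, hx'⟩
        rw [Metric.mem_ball]
        linarith
      · push Not at hc
        refine h y i j ⟨x, ?_, hx⟩ ⟨x', ?_, hx'⟩
        · rw [Metric.mem_ball]
          have := dist_triangle x p y
          rw [dist_comm x p] at this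
          linarith
        · rw [Metric.mem_ball]
          have := dist_triangle x' q y
          rw [dist_comm x' q] at this
          linarith
    rintro i j ⟨p, hpy, -, hp⟩ ⟨q, hqy, -, hq⟩
    obtain ⟨x, hx, hp⟩ := mem_iUnion₂.1 hp
    obtain ⟨x', hx', hq⟩ := mem_iUnion₂.1 hq
    rcases le_total (r x') (r x) with hle | hle
    · exact key i j x x' p q hx hx' hp hq hpy hqy hle
    · exact (key j i x' x q p hx' hx hq hp hqy hpy hle).symm

theorem Homeomorph.mem_iff_of_eqOn_compl {X : Type*} [TopologicalSpace X] (f : X ≃ₜ X)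
    {E : Set X} (hf : ∀ x ∉ E, f x = x) (x : X) : f x ∈ E ↔ x ∈ E := by
  constructor
  · intro h
    by_contra hx
    exact hx (by rwa [hf x hx] at h)
  · intro h
    by_contra hx
    exact hx (by rwa [f.injective (hf _ hx)])

theorem Homeomorph.symm_eq_of_eqOn_compl {X : Type*} [TopologicalSpace X] (f : X ≃ₜ X)
    {E : Set X} (hf : ∀ x ∉ E, f x = x) : ∀ x ∉ E, f.symm x = x := by
  intro x hx
  rw [Homeomorph.symm_apply_eq, hf x hx]

/-- Homeomorphisms supported in the members of a discrete family can be combined. -/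
theorem DiscreteFamily.exists_glue {X ι : Type*} [TopologicalSpace X] {E : ι → Set X}
    (hE : DiscreteFamily E) (f : ι → X ≃ₜ X) (hf : ∀ i, ∀ x ∉ E i, f i x = x) :
    ∃ ψ : X ≃ₜ X, (∀ i, ∀ x ∈ E i, ψ x = f i x) ∧ ∀ x, (∀ i, x ∉ E i) → ψ x = x := by
  classical
  let G : (ι → X ≃ₜ X) → X → X := fun g x =>
    if h : ∃ i, x ∈ E i then g h.choose x else x
  have G1 : ∀ g i x, x ∈ E i → G g x = g i x := by
    intro g i x hx
    have h : ∃ i, x ∈ E i := ⟨i, hx⟩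
    simp only [G, dif_pos h]
    rw [hE.eq_of_mem h.choose_spec hx]
  have G2 : ∀ g x, (∀ i, x ∉ E i) → G g x = x := by
    intro g x hx
    have h : ¬ ∃ i, x ∈ E i := by push Not; exact hx
    simp only [G, dif_neg h]
  have Gc : ∀ g : ι → X ≃ₜ X, (∀ i, ∀ x ∉ E i, g i x = x) → Continuous (G g) := by
    intro g hg
    rw [continuous_iff_continuousAt]
    intro x
    obtain ⟨V, hV, h⟩ := hE x
    by_cases hi : ∃ i, (V ∩ E i).Nonempty
    · obtain ⟨i, hi⟩ := hi
      refine (g i).continuous.continuousAt.congr ?_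
      filter_upwards [hV] with y hy
      by_cases hj : ∃ j, y ∈ E j
      · obtain ⟨j, hj⟩ := hj
        rw [G1 g j y hj, h i j hi ⟨y, hy, hj⟩]
      · push Not at hj
        rw [G2 g y hj, hg i y (hj i)]
    · refine continuousAt_id.congr ?_
      filter_upwards [hV] with y hy
      rw [G2 g y fun j hj => hi ⟨j, y, hy, hj⟩, id]
  have hfs : ∀ i, ∀ x ∉ E i, (f i).symm x = x := fun i =>
    (f i).symm_eq_of_eqOn_compl (hf i)
  have Ginv : ∀ g g' : ι → X ≃ₜ X, (∀ i, ∀ x ∉ E i, g i x = x) →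
      (∀ i x, g' i (g i x) = x) → ∀ x, G g' (G g x) = x := by
    intro g g' hg hgg x
    by_cases hj : ∃ j, x ∈ E j
    · obtain ⟨j, hj⟩ := hj
      rw [G1 g j x hj, G1 g' j _ (((g j).mem_iff_of_eqOn_compl (hg j) x).2 hj), hgg]
    · push Not at hj
      rw [G2 g x hj, G2 g' x hj]
  refine ⟨⟨⟨G f, G fun i => (f i).symm,
    Ginv f (fun i => (f i).symm) hf fun i x => (f i).symm_apply_apply x,
    Ginv (fun i => (f i).symm) f hfs fun i x => (f i).apply_symm_apply x⟩, Gc _ hf, Gc _ hfs⟩,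
    fun i x hx => G1 f i x hx,
    fun x hx => G2 f x hx⟩

/-- Extension by the identity of a homeomorphism of an open subspace. -/
theorem exists_homeomorph_extension {X : Type*} [MetricSpace X] {U : Set X} (hU : IsOpen U)
    (h : U ≃ₜ U)
    (h1 : ∀ x₀ ∉ U, ∀ ρ > 0, ∃ s > 0, ∀ x : U, dist (x : X) x₀ < s → dist (h x : X) x₀ < ρ)
    (h2 : ∀ x₀ ∉ U, ∀ ρ > 0, ∃ s > 0, ∀ x : U, dist (x : X) x₀ < s →
      dist (h.symm x : X) x₀ < ρ) :
    ∃ H : X ≃ₜ X, (∀ x : U, H x = h x) ∧ ∀ x ∉ U, H x = x := by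
  classical
  let G : (U ≃ₜ U) → X → X := fun g x => if hx : x ∈ U then g ⟨x, hx⟩ else x
  have G1 : ∀ g, ∀ x : U, G g x = g x := fun g x => by simp [G]
  have G2 : ∀ g, ∀ x ∉ U, G g x = x := fun g x hx => by simp [G, hx]
  have Gc : ∀ g : U ≃ₜ U, (∀ x₀ ∉ U, ∀ ρ > 0, ∃ s > 0, ∀ x : U, dist (x : X) x₀ < s →
      dist (g x : X) x₀ < ρ) → Continuous (G g) := by
    intro g hg
    rw [continuous_iff_continuousAt]
    intro x
    by_cases hx : x ∈ U
    · have : ContinuousOn (G g) U := by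
        rw [continuousOn_iff_continuous_domRestrict]
        have : U.domRestrict (G g) = fun x => (g x : X) := by
          ext x; exact G1 g x
        rw [this]
        exact continuous_subtype_val.comp g.continuous
      exact this.continuousAt (hU.mem_nhds hx)
    · rw [Metric.continuousAt_iff]
      intro ρ hρ
      obtain ⟨s, hs, h⟩ := hg x hx ρ hρ
      refine ⟨min s ρ, lt_min hs hρ, fun y hy => ?_⟩
      rw [G2 g x hx]
      by_cases hyU : y ∈ U
      · rw [G1 g ⟨y, hyU⟩]
        exact h ⟨y, hyU⟩ (hy.trans_le (min_le_left _ _))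
      · rw [G2 g y hyU]
        exact hy.trans_le (min_le_right _ _)
  have Ginv : ∀ g g' : U ≃ₜ U, (∀ x, g' (g x) = x) → ∀ x, G g' (G g x) = x := by
    intro g g' hgg x
    by_cases hx : x ∈ U
    · rw [G1 g ⟨x, hx⟩, G1 g', hgg]
    · rw [G2 g x hx, G2 g' x hx]
  exact ⟨⟨⟨G h, G h.symm, Ginv _ _ (by simp), Ginv _ _ (by simp)⟩, Gc _ h1, Gc _ h2⟩,
    G1 h, G2 h⟩

namespace Decomposition

variable {X : Type*} [MetricSpace X] {D : Decomposition X}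

theorem eq_of_mem {Y : Type*} [TopologicalSpace Y] (D : Decomposition Y) {a b : Set Y}
    (ha : a ∈ D.pieces) (hb : b ∈ D.pieces) {x : Y} (hxa : x ∈ a) (hxb : x ∈ b) : a = b := by
  by_contra h
  exact disjoint_left.1 (D.disjoint' a ha b hb h) hxa hxb

theorem Vanishing.exists_ball (hD : D.Vanishing) (x₀ : X) {ρ : ℝ} (hρ : 0 < ρ) :
    ∃ s > 0, ∀ a ∈ D.pieces, x₀ ∉ a → (a ∩ Metric.ball x₀ s).Nonempty →
      a ⊆ Metric.ball x₀ ρ := by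
  let 𝒰 : Set (Set X) := {Metric.ball x₀ ρ, (Metric.closedBall x₀ (ρ / 2))ᶜ}
  obtain ⟨V, hV, h⟩ := hD 𝒰 (by
      rintro u (rfl | rfl)
      · exact Metric.isOpen_ball
      · exact Metric.isClosed_closedBall.isOpen_compl)
    (by
      rw [eq_univ_iff_forall]
      intro x
      by_cases hx : x ∈ Metric.ball x₀ ρ
      · exact ⟨_, Or.inl rfl, hx⟩
      · refine ⟨_, Or.inr rfl, fun hx' => hx ?_⟩
        rw [Metric.mem_closedBall] at hx'
        rw [Metric.mem_ball]
        linarith) x₀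
  have bad : ∀ a : Set X, (a ∩ Metric.ball x₀ (ρ / 2)).Nonempty → ¬ a ⊆ Metric.ball x₀ ρ →
      ∀ u ∈ 𝒰, ¬ a ⊆ u := by
    rintro a ⟨y, hya, hy⟩ ha u (rfl | rfl) hau
    · exact ha hau
    · exact hau hya (Metric.ball_subset_closedBall hy)
  by_cases hc : ∃ c ∈ D.pieces, x₀ ∉ c ∧ (∀ u ∈ 𝒰, ¬ c ⊆ u) ∧ (V ∩ c).Nonempty
  · obtain ⟨c, hcD, hxc, hcb, hVc⟩ := hc
    have hW : V ∩ cᶜ ∩ Metric.ball x₀ (ρ / 2) ∈ 𝓝 x₀ :=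
      Filter.inter_mem (Filter.inter_mem hV ((D.isCompact' c hcD).isClosed.isOpen_compl.mem_nhds
        hxc)) (Metric.ball_mem_nhds _ (by linarith))
    obtain ⟨s, hs, hsW⟩ := Metric.mem_nhds_iff.1 hW
    refine ⟨s, hs, fun a ha hxa hne => ?_⟩
    obtain ⟨y, hya, hy⟩ := hne
    by_contra hcon
    have hy' := hsW hy
    have := h a ha (bad a ⟨y, hya, hy'.2⟩ hcon) c hcD hcb ⟨y, hy'.1.1, hya⟩ hVc
    exact hy'.1.2 (this ▸ hya)
  · have hW : V ∩ Metric.ball x₀ (ρ / 2) ∈ 𝓝 x₀ :=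
      Filter.inter_mem hV (Metric.ball_mem_nhds _ (by linarith))
    obtain ⟨s, hs, hsW⟩ := Metric.mem_nhds_iff.1 hW
    refine ⟨s, hs, fun a ha hxa hne => ?_⟩
    obtain ⟨y, hya, hy⟩ := hne
    by_contra hcon
    have hy' := hsW hy
    exact hc ⟨a, ha, hxa, bad a ⟨y, hya, hy'.2⟩ hcon, y, hy'.1, hya⟩

theorem Vanishing.exists_saturated_open (hD : D.Vanishing) {a G : Set X} (ha : a ∈ D.pieces)
    (hG : IsOpen G) (haG : a ⊆ G) :
    ∃ W, IsOpen W ∧ D.Saturated W ∧ a ⊆ W ∧ W ⊆ G := by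
  refine ⟨⋃₀ {c ∈ D.pieces | c ⊆ G}, ?_, ?_, subset_sUnion_of_mem ⟨ha, haG⟩,
    sUnion_subset fun c hc => hc.2⟩
  · rw [Metric.isOpen_iff]
    rintro x ⟨c, ⟨hc, hcG⟩, hxc⟩
    obtain ⟨ρ, hρ, hρG⟩ := Metric.isOpen_iff.1 hG x (hcG hxc)
    obtain ⟨s, hs, h⟩ := hD.exists_ball x hρ
    refine ⟨s, hs, fun y hy => ?_⟩
    obtain ⟨c', hc', hyc'⟩ := D.covers y
    refine ⟨c', ⟨hc', ?_⟩, hyc'⟩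
    by_cases hx : x ∈ c'
    · rw [D.eq_of_mem hc' hc hx hxc]; exact hcG
    · exact (h c' hc' hx ⟨y, hyc', hy⟩).trans hρG
  · rintro b hb ⟨y, hyb, c, hc, hyc⟩
    rw [D.eq_of_mem hb hc.1 hyb hyc]
    exact subset_sUnion_of_mem hc

theorem Vanishing.discreteFamily_not_small (hD : D.Vanishing) {δ : ℝ} (hδ : 0 < δ)
    (P : Set X → Prop) :
    DiscreteFamily fun a : {a : Set X // a ∈ D.pieces ∧ ¬ SmallSet δ a ∧ P a} => a.1 := by
  intro x
  obtain ⟨V, hV, h⟩ := hD (range fun x => Metric.ball x (δ / 2))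
    (by rintro u ⟨y, rfl⟩; exact Metric.isOpen_ball)
    (by
      rw [eq_univ_iff_forall]
      exact fun y => ⟨_, ⟨y, rfl⟩, Metric.mem_ball_self (by linarith)⟩) x
  have big : ∀ a : Set X, ¬ SmallSet δ a →
      ∀ u ∈ range fun x => Metric.ball x (δ / 2), ¬ a ⊆ u := by
    rintro a ha _ ⟨y, rfl⟩ hay
    refine ha fun p hp q hq => ?_
    have h1 := Metric.mem_ball.1 (hay hp)
    have h2 := Metric.mem_ball.1 (hay hq)
    have := dist_triangle_right p q y
    linarith
  exact ⟨V, hV, fun i j hi hj => Subtype.ext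
    (h _ i.2.1 (big _ i.2.2.1) _ j.2.1 (big _ j.2.2.1) hi hj)⟩

/-- Shrinking the pieces of a decomposition missing a closed saturated set, by a homeomorphism
of the whole space which is the identity on that set. -/
theorem exists_shrinking (hD : D.Vanishing) (hS : D.StronglyShrinkable) {S : Set X}
    (hSc : IsClosed S) (hSs : D.Saturated S) (G : Set X → Set X)
    (hG : ∀ a ∈ D.pieces, IsOpen (G a)) (haG : ∀ a ∈ D.pieces, a ⊆ G a)
    (𝒱 : Set (Set X)) (h𝒱 : ∀ v ∈ 𝒱, IsOpen v) (h𝒱c : ⋃₀ 𝒱 = univ) :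
    ∃ h : X ≃ₜ X, (∀ x ∈ S, h x = x) ∧
      (∀ x, h x = x ∨ ∃ a ∈ D.pieces, Disjoint a S ∧ x ∈ G a ∧ h x ∈ G a) ∧
      ∀ a ∈ D.pieces, Disjoint a S → ∃ v ∈ 𝒱, ⇑h '' a ⊆ v := by
  have hW : ∀ a : {a : Set X // a ∈ D.pieces ∧ Disjoint a S}, ∃ r > 0, ∃ W, IsOpen W ∧
      D.Saturated W ∧ a.1 ⊆ W ∧ W ⊆ G a ∧ W ⊆ Sᶜ ∧ W ⊆ Metric.thickening r a.1 ∧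
      ∀ p ∈ a.1, ∀ s ∈ S, 2 * r ≤ dist p s := by
    rintro ⟨a, ha, haS⟩
    obtain ⟨δ, hδ, hdis⟩ := haS.exists_thickenings (D.isCompact' a ha) hSc
    obtain ⟨W, hWo, hWs, haW, hWG⟩ := hD.exists_saturated_open ha
      (((hG a ha).inter hSc.isOpen_compl).inter (Metric.isOpen_thickening (δ := δ / 2) (E := a)))
      (subset_inter (subset_inter (haG a ha) (disjoint_left.1 haS))
        (Metric.self_subset_thickening (by linarith) a))
    refine ⟨δ / 2, by linarith, W, hWo, hWs, haW, fun x hx => (hWG hx).1.1,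
      fun x hx => (hWG hx).1.2, fun x hx => (hWG hx).2, fun p hp s hs => ?_⟩
    by_contra hcon
    refine disjoint_left.1 hdis (Metric.self_subset_thickening hδ a hp)
      (Metric.mem_thickening_iff.2 ⟨s, hs, by linarith⟩)
  choose r hr W hWo hWs haW hWG hWS hWr hWd using hW
  have hUs : D.Saturated Sᶜ := by
    rintro a ha ⟨x, hxa, hxS⟩ y hya hyS
    exact hxS (hSs a ha ⟨y, hya, hyS⟩ hxa)
  obtain ⟨h, hnear, hsmall⟩ := hS Sᶜ hSc.isOpen_compl hUs (range W)
    (by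
      rintro _ ⟨a, rfl⟩
      exact ⟨hWo a, hWS a, fun b hb _ => hWs a b hb⟩)
    (by
      intro x hx
      obtain ⟨a, ha, hxa⟩ := D.covers x
      have haS : Disjoint a S := disjoint_left.2 (hUs a ha ⟨x, hxa, hx⟩)
      exact ⟨_, ⟨⟨a, ha, haS⟩, rfl⟩, haW _ hxa⟩)
    ((fun v => v ∩ Sᶜ) '' 𝒱)
    (by
      rintro _ ⟨v, hv, rfl⟩
      exact ⟨(h𝒱 v hv).inter hSc.isOpen_compl, inter_subset_right⟩)
    (by
      intro x hx
      obtain ⟨v, hv, hxv⟩ := h𝒱c.symm ▸ mem_univ x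
      exact ⟨_, ⟨v, hv, rfl⟩, hxv, hx⟩)
  have hloc : ∀ x₀ ∉ Sᶜ, ∀ ρ > 0, ∃ s > 0, ∀ a x y, dist x x₀ < s → x ∈ W a → y ∈ W a →
      dist y x₀ < ρ := by
    intro x₀ hx₀ ρ hρ
    obtain ⟨s, hs, hball⟩ := hD.exists_ball x₀ (half_pos hρ)
    refine ⟨min (s / 2) (ρ / 2), by positivity, fun a x y hx hxW hyW => ?_⟩
    rw [lt_min_iff] at hx
    have hx₀S : x₀ ∈ S := not_not.1 hx₀
    obtain ⟨p, hp, hxp⟩ := Metric.mem_thickening_iff.1 (hWr a hxW)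
    obtain ⟨q, hq, hyq⟩ := Metric.mem_thickening_iff.1 (hWr a hyW)
    have d1 := hWd a p hp x₀ hx₀S
    have d2 := dist_triangle_left p x₀ x
    have hsub : a.1 ⊆ Metric.ball x₀ (ρ / 2) := by
      refine hball _ a.2.1 (fun h => disjoint_left.1 a.2.2 h hx₀S) ⟨p, hp, ?_⟩
      rw [Metric.mem_ball]
      linarith
    have d3 := Metric.mem_ball.1 (hsub hq)
    have d4 := dist_triangle y q x₀
    linarith
  have hnear' : ∀ x : (Sᶜ : Set X), h x = x ∨ ∃ a, (x : X) ∈ W a ∧ (h x : X) ∈ W a := by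
    intro x
    by_cases hx : h x = x
    · exact Or.inl hx
    · obtain ⟨_, ⟨a, rfl⟩, h1, h2⟩ := hnear x fun h' => hx (Subtype.ext h')
      exact Or.inr ⟨a, h2, h1⟩
  obtain ⟨H, hH1, hH2⟩ := exists_homeomorph_extension hSc.isOpen_compl h
    (by
      intro x₀ hx₀ ρ hρ
      obtain ⟨s, hs, hl⟩ := hloc x₀ hx₀ ρ hρ
      refine ⟨min s ρ, lt_min hs hρ, fun x hx => ?_⟩
      rcases hnear' x with he | ⟨a, h1, h2⟩
      · rw [he]; exact hx.trans_le (min_le_right _ _)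
      · exact hl a x _ (hx.trans_le (min_le_left _ _)) h1 h2)
    (by
      intro x₀ hx₀ ρ hρ
      obtain ⟨s, hs, hl⟩ := hloc x₀ hx₀ ρ hρ
      refine ⟨min s ρ, lt_min hs hρ, fun x hx => ?_⟩
      rcases hnear' (h.symm x) with he | ⟨a, h1, h2⟩
      · rw [← he, h.apply_symm_apply]; exact hx.trans_le (min_le_right _ _)
      · rw [h.apply_symm_apply] at h2
        exact hl a x _ (hx.trans_le (min_le_left _ _)) h2 h1)
  refine ⟨H, fun x hx => hH2 x (not_not.2 hx), fun x => ?_, fun a ha haS => ?_⟩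
  · by_cases hx : x ∈ Sᶜ
    · rcases hnear' ⟨x, hx⟩ with he | ⟨a, h1, h2⟩
      · left
        rw [hH1 ⟨x, hx⟩, he]
      · right
        refine ⟨a, a.2.1, a.2.2, hWG a h1, ?_⟩
        rw [hH1 ⟨x, hx⟩]
        exact hWG a h2
    · exact Or.inl (hH2 x hx)
  · obtain ⟨_, ⟨v, hv, rfl⟩, hsub⟩ := hsmall a ha (disjoint_left.1 haS)
    refine ⟨v, hv, ?_⟩
    rintro _ ⟨x, hx, rfl⟩
    have hxS : x ∈ Sᶜ := disjoint_left.1 haS hx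
    rw [hH1 ⟨x, hxS⟩]
    exact (hsub ⟨h ⟨x, hxS⟩, ⟨⟨x, hxS⟩, hx, rfl⟩, rfl⟩).1

end Decomposition

/-- A member of a tame family can be moved close to any of its points. -/
theorem IsTameFamily.exists_shift_into {X : Type*} [TopologicalSpace X] {𝒦 : Set (Set X)}
    (h𝒦 : IsTameFamily 𝒦) {K O N : Set X} (hK : K ∈ 𝒦) (hO : IsOpen O) (hKO : K ⊆ O) {p : X}
    (hp : p ∈ K) (hN : N ∈ 𝓝 p) :
    ∃ f : X ≃ₜ X, (∀ x ∉ O, f x = x) ∧ ⇑f '' K ⊆ N := by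
  obtain ⟨-, hamb, hshr, hlsp, hne⟩ := h𝒦
  have : ∀ x : O, ∃ U : Set X, IsOpen U ∧ x.1 ∈ U ∧ U ⊆ O ∧ ∀ A ∈ 𝒦, ∀ B ∈ 𝒦, A ⊆ U → B ⊆ U →
      ∃ h : X ≃ₜ X, ⇑h '' A = B ∧ ∀ y ∉ O, h y = y := by
    intro x
    obtain ⟨U, hU, hUO, h⟩ := hlsp x O (hO.mem_nhds x.2)
    exact ⟨interior U, isOpen_interior, mem_interior_iff_mem_nhds.2 hU,
      interior_subset.trans hUO, fun A hA B hB hAU hBU => h A hA B hB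
        (hAU.trans interior_subset) (hBU.trans interior_subset)⟩
  choose U hUo hxU hUO hU using this
  obtain ⟨h, hhO, _, ⟨x, rfl⟩, hKU⟩ := hshr K hK O hO hKO (range U)
    (by rintro _ ⟨x, rfl⟩; exact ⟨hUo x, hUO x⟩)
    (fun x hx => ⟨_, ⟨⟨x, hx⟩, rfl⟩, hxU ⟨x, hx⟩⟩)
  obtain ⟨B, hB, hBsub⟩ := hne (U x ∩ h.symm ⁻¹' interior N)
    ((hUo x).inter (isOpen_interior.preimage h.symm.continuous))
    ⟨h p, hKU ⟨p, hp, rfl⟩, by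
      rw [mem_preimage, h.symm_apply_apply]
      exact mem_interior_iff_mem_nhds.2 hN⟩
  obtain ⟨s, hsB, hsO⟩ := hU x _ (hamb h K hK) B hB hKU fun y hy => (hBsub hy).1
  refine ⟨(h.trans s).trans h.symm, fun y hy => ?_, ?_⟩
  · simp [hhO y hy, hsO y hy, h.symm_eq_of_eqOn_compl hhO y hy]
  · rintro _ ⟨y, hy, rfl⟩
    have : s (h y) ∈ B := hsB ▸ mem_image_of_mem _ (mem_image_of_mem _ hy)
    exact interior_subset (hBsub this).2

theorem Decomposition.IsDenseDecomp.exists_nondeg {X : Type*} [TopologicalSpace X]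
    {D : Decomposition X} (hD : D.IsDenseDecomp) {W : Set X} (hW : IsOpen W)
    (hWs : D.Saturated W) (hne : W.Nonempty) :
    ∃ b ∈ D.pieces, ¬ b.Subsingleton ∧ b ⊆ W := by
  have hq : ∀ x, x ∈ (D.q x).1 := fun x => (D.covers x).choose_spec.2
  have ho : IsOpen {a : D.Space | a.1 ⊆ W} := by
    change IsOpen (D.q ⁻¹' _)
    convert hW using 1
    ext x
    exact ⟨fun h => h (hq x), fun h => hWs _ (D.q x).2 ⟨x, hq x, h⟩⟩
  obtain ⟨x, hx⟩ := hne
  obtain ⟨b, hbW, hb⟩ := hD.inter_open_nonempty _ ho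
    ⟨D.q x, hWs _ (D.q x).2 ⟨x, hq x, hx⟩⟩
  exact ⟨b.1, b.2, hb, hbW⟩

/-- A member of a tame family can be moved onto a piece of a dense tame decomposition. -/
theorem IsTameFamily.exists_move_onto_piece {X : Type*} [MetricSpace X] {𝒦 : Set (Set X)}
    (h𝒦 : IsTameFamily 𝒦) {D : Decomposition X} (hD : D.KTame 𝒦) (hDd : D.IsDenseDecomp)
    {K O : Set X} (hK : K ∈ 𝒦) (hO : IsOpen O) (hKO : K ⊆ O) (hKne : K.Nonempty)
    (hDO : ∀ b ∈ D.pieces, (b ∩ K).Nonempty → b ⊆ O) :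
    ∃ f : X ≃ₜ X, (∀ x ∉ O, f x = x) ∧ ⇑f '' K ∈ D.pieces := by
  obtain ⟨p, hp⟩ := hKne
  obtain ⟨b, hb, hpb⟩ := D.covers p
  have hbO := hDO b hb ⟨p, hpb, hp⟩
  obtain ⟨U, hU, hUO, hlsp⟩ := h𝒦.2.2.2.1 p O (hO.mem_nhds (hKO hp))
  have : ∃ L ∈ D.pieces, L ∈ 𝒦 ∧ ∃ g : X ≃ₜ X, (∀ x ∉ O, g x = x) ∧ ⇑g '' L ⊆ U := by
    by_cases hbs : b.Subsingleton
    · have hbU : b ⊆ interior U := fun x hx => by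
        rw [hbs hx hpb]; exact mem_interior_iff_mem_nhds.2 hU
      obtain ⟨W, hWo, hWs, hbW, hWU⟩ := hD.1.exists_saturated_open hb isOpen_interior hbU
      obtain ⟨L, hL, hLs, hLW⟩ := hDd.exists_nondeg hWo hWs ⟨p, hbW hpb⟩
      refine ⟨L, hL, hD.2.2 L hL hLs, Homeomorph.refl X, fun x _ => rfl, ?_⟩
      rintro _ ⟨x, hx, rfl⟩
      exact interior_subset (hWU (hLW hx))
    · obtain ⟨g, hg, hgU⟩ := h𝒦.exists_shift_into (hD.2.2 b hb hbs) hO hbO hpb hU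
      exact ⟨b, hb, hD.2.2 b hb hbs, g, hg, hgU⟩
  obtain ⟨L, hL, hLK, g, hg, hgU⟩ := this
  obtain ⟨f, hf, hfU⟩ := h𝒦.exists_shift_into hK hO hKO hp hU
  obtain ⟨s, hs, hsO⟩ := hlsp _ (h𝒦.2.1 f K hK) _ (h𝒦.2.1 g L hLK) hfU hgU
  refine ⟨(f.trans s).trans g.symm, fun x hx => ?_, ?_⟩
  · simp [hf x hx, hsO x hx, g.symm_eq_of_eqOn_compl hg x hx]
  · have : ⇑((f.trans s).trans g.symm) '' K = L := by
      have : ⇑((f.trans s).trans g.symm) '' K = g.symm '' (s '' (f '' K)) := by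
        rw [image_image, image_image]
        rfl
      rw [this, hs, image_image]
      simp
    rw [this]
    exact hL

/-- `Φ` matches the pieces of `A` in the closed saturated set `S` with pieces of `B`. -/
structure Matches {X : Type*} [TopologicalSpace X] (A B : Decomposition X) (Φ : X ≃ₜ X)
    (S : Set X) : Prop where
  isClosed : IsClosed S
  saturated : A.Saturated S
  image_mem : ∀ a ∈ A.pieces, a ⊆ S → ⇑Φ '' a ∈ B.pieces

theorem Matches.exists_image_eq {X : Type*} [TopologicalSpace X] {A B : Decomposition X}
    {Φ : X ≃ₜ X} {S : Set X} (h : Matches A B Φ S) {b : Set X} (hb : b ∈ B.pieces)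
    (hne : (b ∩ ⇑Φ '' S).Nonempty) : ∃ a ∈ A.pieces, a ⊆ S ∧ ⇑Φ '' a = b := by
  obtain ⟨_, hyb, x, hxS, rfl⟩ := hne
  obtain ⟨a, ha, hxa⟩ := A.covers x
  have haS := h.saturated a ha ⟨x, hxa, hxS⟩
  exact ⟨a, ha, haS, B.eq_of_mem (h.image_mem a ha haS) hb (mem_image_of_mem _ hxa) hyb⟩

theorem Matches.symm {X : Type*} [TopologicalSpace X] {A B : Decomposition X} {Φ : X ≃ₜ X}
    {S : Set X} (h : Matches A B Φ S) : Matches B A Φ.symm (⇑Φ '' S) := by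
  refine ⟨Φ.isClosed_image.2 h.isClosed, fun b hb hne => ?_, fun b hb hbS => ?_⟩
  · obtain ⟨a, -, haS, rfl⟩ := h.exists_image_eq hb hne
    exact image_mono haS
  · obtain ⟨y, hy⟩ := B.nonempty' b hb
    obtain ⟨a, ha, -, rfl⟩ := h.exists_image_eq hb ⟨y, hy, hbS hy⟩
    simpa [image_image] using ha

/-- Matching all the pieces of `A` which are not small, by composing with a homeomorphism `ψ`
supported near these pieces and a homeomorphism `k` supported near pieces of `B`. -/
theorem Matches.exists_extend {X : Type*} [MetricSpace X] {𝒦 : Set (Set X)}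
    (h𝒦 : IsTameFamily 𝒦) {A B : Decomposition X} (hA : A.KTame 𝒦) (hB : B.KTame 𝒦)
    (hBd : B.IsDenseDecomp) {Φ : X ≃ₜ X} {S : Set X} (h : Matches A B Φ S) {δ : ℝ}
    (hδ : 0 < δ) (G H : Set X → Set X)
    (hGo : ∀ a ∈ A.pieces, IsOpen (G a)) (hG : ∀ a ∈ A.pieces, a ⊆ G a)
    (hHo : ∀ b ∈ B.pieces, IsOpen (H b)) (hH : ∀ b ∈ B.pieces, b ⊆ H b) :
    ∃ (k ψ : X ≃ₜ X) (S' : Set X), Matches A B ((ψ.trans Φ).trans k) S' ∧ S ⊆ S' ∧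
      (∀ x ∈ S, k (Φ (ψ x)) = Φ x) ∧
      (∀ y, k y = y ∨ ∃ b ∈ B.pieces, Disjoint b (⇑Φ '' S) ∧ y ∈ H b ∧ k y ∈ H b) ∧
      (∀ x, ψ x = x ∨ ∃ a ∈ A.pieces, Disjoint a S ∧ ¬ SmallSet δ a ∧ x ∈ G a ∧ ψ x ∈ G a) ∧
      (∀ b ∈ B.pieces, Disjoint b (⇑Φ '' S) → SmallSet δ ((fun x => k (Φ x)) ⁻¹' b)) ∧
      (∀ a ∈ A.pieces, Disjoint a S' → SmallSet δ a) := by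
  let ι := {a : Set X // a ∈ A.pieces ∧ ¬ SmallSet δ a ∧ Disjoint a S}
  have hdisc : DiscreteFamily fun a : ι => a.1 :=
    hA.1.discreteFamily_not_small hδ fun a => Disjoint a S
  have hcl : ∀ a : ι, IsClosed a.1 := fun a => (A.isCompact' a.1 a.2.1).isClosed
  obtain ⟨E, hEo, haE, hEG, hE⟩ := hdisc.exists_open_expansion
    (N := fun a : ι => G a.1 ∩ Sᶜ) (fun a => (hGo a.1 a.2.1).inter h.isClosed.isOpen_compl)
    (fun a => subset_inter (hG a.1 a.2.1) (disjoint_left.1 a.2.2.2))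
  let 𝒱₀ : Set (Set X) := {v | IsOpen v ∧ SmallSet δ v ∧
    ∀ a : ι, (v ∩ a.1).Nonempty → v ⊆ E a}
  have hball : ∀ x : X, SmallSet δ (Metric.ball x (δ / 2)) := fun x p hp q hq => by
    have h1 := Metric.mem_ball.1 hp
    have h2 := Metric.mem_ball.1 hq
    have := dist_triangle_right p q x
    linarith
  have h𝒱₀ : ∀ x, ∃ v ∈ 𝒱₀, x ∈ v := by
    intro x
    by_cases hx : ∃ a : ι, x ∈ a.1
    · obtain ⟨a, hxa⟩ := hx
      refine ⟨E a ∩ Metric.ball x (δ / 2), ⟨(hEo a).inter Metric.isOpen_ball,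
        fun p hp q hq => hball x p hp.2 q hq.2, ?_⟩, haE a hxa,
        Metric.mem_ball_self (half_pos hδ)⟩
      rintro b ⟨y, hy, hyb⟩
      rw [hE.eq_of_mem (haE b hyb) hy.1]
      exact inter_subset_left
    · refine ⟨(⋃ a : ι, a.1)ᶜ ∩ Metric.ball x (δ / 2),
        ⟨(hdisc.isClosed_iUnion hcl).isOpen_compl.inter Metric.isOpen_ball,
        fun p hp q hq => hball x p hp.2 q hq.2, ?_⟩, ?_, Metric.mem_ball_self (half_pos hδ)⟩
      · rintro b ⟨y, hy, hyb⟩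
        exact absurd (mem_iUnion.2 ⟨b, hyb⟩) hy.1
      · simpa using hx
  have hs := h.symm
  obtain ⟨κ, hκS, hκH, hκ⟩ := Decomposition.exists_shrinking hB.1 hB.2.1 hs.isClosed
    hs.saturated H hHo hH ((fun v => ⇑Φ '' v) '' 𝒱₀)
    (by
      rintro _ ⟨v, hv, rfl⟩
      exact Φ.isOpen_image.2 hv.1)
    (by
      rw [eq_univ_iff_forall]
      intro y
      obtain ⟨v, hv, hyv⟩ := h𝒱₀ (Φ.symm y)
      exact ⟨_, ⟨v, hv, rfl⟩, Φ.symm y, hyv, Φ.apply_symm_apply y⟩)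
  let Φ₁ := Φ.trans κ.symm
  have hΦ₁S : ∀ x ∈ S, Φ₁ x = Φ x := by
    intro x hx
    change κ.symm (Φ x) = Φ x
    rw [Homeomorph.symm_apply_eq, hκS _ (mem_image_of_mem _ hx)]
  have hpre : ∀ b ∈ B.pieces, Disjoint b (⇑Φ '' S) → ∃ v ∈ 𝒱₀, ⇑Φ₁ ⁻¹' b ⊆ v := by
    intro b hb hbS
    obtain ⟨_, ⟨v, hv, rfl⟩, hsub⟩ := hκ b hb hbS
    refine ⟨v, hv, fun x hx => ?_⟩
    obtain ⟨x', hx', he⟩ := hsub (mem_image_of_mem _ hx)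
    have : Φ x' = Φ x := by
      rw [he]
      exact κ.apply_symm_apply _
    rwa [← Φ.injective this]
  have hmove : ∀ a : ι, ∃ f : X ≃ₜ X, (∀ x ∉ ⇑Φ₁ '' E a, f x = x) ∧
      ⇑f '' (⇑Φ₁ '' a.1) ∈ B.pieces := by
    intro a
    have hans : ¬ a.1.Subsingleton := fun hs => a.2.2.1 fun x hx y hy => by
      rw [hs hx hy, dist_self]; exact hδ.le
    refine h𝒦.exists_move_onto_piece hB hBd (h𝒦.2.1 Φ₁ _ (hA.2.2 a.1 a.2.1 hans))
      (Φ₁.isOpen_image.2 (hEo a)) (image_mono (haE a))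
      ((A.nonempty' a.1 a.2.1).image _) ?_
    rintro b hb ⟨_, hyb, x, hxa, rfl⟩
    have hbS : Disjoint b (⇑Φ '' S) := by
      rw [disjoint_left]
      intro y hyb' hyS
      obtain ⟨x', hx'S, hx'⟩ := hs.saturated b hb ⟨y, hyb', hyS⟩ hyb
      rw [← hΦ₁S x' hx'S] at hx'
      rw [Φ₁.injective hx'] at hx'S
      exact disjoint_left.1 a.2.2.2 hxa hx'S
    obtain ⟨v, hv, hbv⟩ := hpre b hb hbS
    have hvE := hv.2.2 a ⟨x, hbv hyb, hxa⟩
    intro y hy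
    exact ⟨Φ₁.symm y, hvE (hbv (by simpa using hy)), Φ₁.apply_symm_apply y⟩
  choose f hf hfB using hmove
  have hgE : ∀ a, ∀ x ∉ E a, ((Φ₁.trans (f a)).trans Φ₁.symm) x = x := by
    intro a x hx
    change Φ₁.symm (f a (Φ₁ x)) = x
    rw [hf a _ fun h' => hx ?_, Φ₁.symm_apply_apply]
    obtain ⟨x', hx', he⟩ := h'
    rwa [← Φ₁.injective he]
  obtain ⟨ψ, hψE, hψ⟩ := hE.exists_glue _ hgE
  have hψS : ∀ x ∈ S, ψ x = x := fun x hx => hψ x fun a hxE => (hEG a hxE).2 hx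
  have hΦ₂ : ∀ x, ((ψ.trans Φ).trans κ.symm) x = Φ₁ (ψ x) := fun x => rfl
  have hΦ₂E : ∀ a, ∀ x ∈ E a, Φ₁ (ψ x) = f a (Φ₁ x) := fun a x hx => by
    rw [hψE a x hx]
    exact Φ₁.apply_symm_apply _
  refine ⟨κ.symm, ψ, S ∪ ⋃ a : ι, a.1, ⟨h.isClosed.union (hdisc.isClosed_iUnion hcl), ?_, ?_⟩,
    subset_union_left, ?_, ?_, ?_, ?_, ?_⟩
  · rintro a ha ⟨x, hxa, hx | hx⟩
    · exact (h.saturated a ha ⟨x, hxa, hx⟩).trans subset_union_left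
    · obtain ⟨b, hxb⟩ := mem_iUnion.1 hx
      rw [A.eq_of_mem ha b.2.1 hxa hxb]
      exact (subset_iUnion (fun a : ι => a.1) b).trans subset_union_right
  · intro a ha haS
    obtain ⟨x, hxa⟩ := A.nonempty' a ha
    rcases haS hxa with hx | hx
    · have haS' := h.saturated a ha ⟨x, hxa, hx⟩
      convert h.image_mem a ha haS' using 1
      refine image_congr fun y hy => ?_
      rw [hΦ₂, hψS y (haS' hy), hΦ₁S y (haS' hy)]
    · obtain ⟨b, hxb⟩ := mem_iUnion.1 hx
      have hab := A.eq_of_mem ha b.2.1 hxa hxb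
      convert hfB b using 1
      rw [image_image, hab]
      refine image_congr fun y hy => ?_
      rw [hΦ₂, hΦ₂E b y (haE b hy)]
  · intro x hx
    rw [hψS x hx]
    exact hΦ₁S x hx
  · intro y
    rcases hκH (κ.symm y) with he | ⟨b, hb, hbS, h1, h2⟩
    · left
      rw [← he, κ.apply_symm_apply]
    · right
      rw [κ.apply_symm_apply] at h2
      exact ⟨b, hb, hbS, h2, h1⟩
  · intro x
    by_cases hx : ∃ a, x ∈ E a
    · obtain ⟨a, hxE⟩ := hx
      right
      refine ⟨a.1, a.2.1, a.2.2.2, a.2.2.1, (hEG a hxE).1, ?_⟩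
      rw [hψE a x hxE]
      exact (hEG a ((Homeomorph.mem_iff_of_eqOn_compl _ (hgE a) x).2 hxE)).1
    · push Not at hx
      exact Or.inl (hψ x hx)
  · intro b hb hbS x hx y hy
    obtain ⟨v, hv, hbv⟩ := hpre b hb hbS
    exact hv.2.1 x (hbv hx) y (hbv hy)
  · intro a ha haS
    by_contra hbig
    have haS' : Disjoint a S := haS.mono_right subset_union_left
    obtain ⟨x, hxa⟩ := A.nonempty' a ha
    exact disjoint_left.1 haS hxa (Or.inr (mem_iUnion.2 ⟨⟨a, ha, hbig, haS'⟩, hxa⟩))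

theorem SmallSet.mono {X : Type*} [MetricSpace X] {α β : ℝ} {a : Set X} (h : SmallSet α a)
    (hαβ : α ≤ β) : SmallSet β a :=
  fun x hx y hy => (h x hx y hy).trans hαβ

theorem SmallSet.dist_le_of_mem_thickening {X : Type*} [MetricSpace X] {α δ : ℝ} {a : Set X}
    (h : SmallSet α a) {x y : X} (hx : x ∈ Metric.thickening δ a)
    (hy : y ∈ Metric.thickening δ a) : dist x y ≤ α + 2 * δ := by
  obtain ⟨p, hp, hxp⟩ := Metric.mem_thickening_iff.1 hx
  obtain ⟨q, hq, hyq⟩ := Metric.mem_thickening_iff.1 hy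
  have h1 := h p hp q hq
  have h2 := dist_triangle4_right x y p q
  linarith

/-- The pieces of `A` missing `S`, and their images under `Φ`, have diameters bounded by the
two given numbers. -/
def SmallOff {X : Type*} [MetricSpace X] (A : Decomposition X) (Φ : X ≃ₜ X) (S : Set X)
    (α α' : ℝ) : Prop :=
  ∀ a ∈ A.pieces, Disjoint a S → SmallSet α a ∧ SmallSet α' (⇑Φ '' a)

theorem SmallOff.mono {X : Type*} [MetricSpace X] {A : Decomposition X} {Φ : X ≃ₜ X}
    {S : Set X} {α α' β β' : ℝ} (h : SmallOff A Φ S α α') (h1 : α ≤ β) (h2 : α' ≤ β') :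
    SmallOff A Φ S β β' :=
  fun a ha haS => ⟨(h a ha haS).1.mono h1, (h a ha haS).2.mono h2⟩

theorem Homeomorph.symm_image_image {X Y : Type*} [TopologicalSpace X] [TopologicalSpace Y]
    (Φ : X ≃ₜ Y) (S : Set X) : ⇑Φ.symm '' (⇑Φ '' S) = S := by
  simp [image_image]

/-- A version of `Matches.exists_extend` with bounds on the displacement. -/
theorem Matches.exists_extend_of_smallOff {X : Type*} [MetricSpace X] {𝒦 : Set (Set X)}
    (h𝒦 : IsTameFamily 𝒦) {A B : Decomposition X} (hA : A.KTame 𝒦) (hB : B.KTame 𝒦)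
    (hBd : B.IsDenseDecomp) {Φ : X ≃ₜ X} {S : Set X} (h : Matches A B Φ S)
    {δ α α' β β' : ℝ} (hδ : 0 < δ) (hα : 0 ≤ α) (hα' : 0 ≤ α') (hβ : 0 ≤ β) (hβ' : 0 ≤ β')
    (hAs : SmallOff A Φ S α α') (hBs : SmallOff B Φ.symm (⇑Φ '' S) β β') :
    ∃ (Φ' : X ≃ₜ X) (S' : Set X), Matches A B Φ' S' ∧ S ⊆ S' ∧ (∀ x ∈ S, Φ' x = Φ x) ∧
      SmallOff A Φ' S' δ (α' + 2 * (α' + β + 4 * δ)) ∧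
      SmallOff B Φ'.symm (⇑Φ' '' S') β (δ + 2 * (α + 2 * δ)) ∧
      (∀ x, dist (Φ' x) (Φ x) ≤ α' + β + 4 * δ) ∧
      ∀ y, dist (Φ'.symm y) (Φ.symm y) ≤ α + β' + 4 * δ := by
  obtain ⟨k, ψ, S', hm, hSS', hS, hk, hψ, hpre, hsmall⟩ := h.exists_extend h𝒦 hA hB hBd hδ
    (fun a => Metric.thickening δ a ∩ Φ ⁻¹' Metric.thickening δ (Φ '' a))
    (fun b => Metric.thickening δ b ∩ Φ.symm ⁻¹' Metric.thickening δ (Φ.symm '' b))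
    (fun a _ => Metric.isOpen_thickening.inter
      (Metric.isOpen_thickening.preimage Φ.continuous))
    (fun a _ => subset_inter (Metric.self_subset_thickening hδ a) (image_subset_iff.1
      (Metric.self_subset_thickening hδ _)))
    (fun b _ => Metric.isOpen_thickening.inter
      (Metric.isOpen_thickening.preimage Φ.symm.continuous))
    (fun b _ => subset_inter (Metric.self_subset_thickening hδ b) (image_subset_iff.1
      (Metric.self_subset_thickening hδ _)))
  have hψ1 : ∀ x, dist (ψ x) x ≤ α + 2 * δ := fun x => by
    rcases hψ x with he | ⟨a, ha, haS, -, h1, h2⟩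
    · rw [he, dist_self]; positivity
    · exact (hAs a ha haS).1.dist_le_of_mem_thickening h2.1 h1.1
  have hψ2 : ∀ x, dist (Φ (ψ x)) (Φ x) ≤ α' + 2 * δ := fun x => by
    rcases hψ x with he | ⟨a, ha, haS, -, h1, h2⟩
    · rw [he, dist_self]; positivity
    · exact (hAs a ha haS).2.dist_le_of_mem_thickening h2.2 h1.2
  have hk1 : ∀ y, dist (k y) y ≤ β + 2 * δ := fun y => by
    rcases hk y with he | ⟨b, hb, hbS, h1, h2⟩
    · rw [he, dist_self]; positivity
    · exact (hBs b hb hbS).1.dist_le_of_mem_thickening h2.1 h1.1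
  have hk2 : ∀ y, dist (Φ.symm (k y)) (Φ.symm y) ≤ β' + 2 * δ := fun y => by
    rcases hk y with he | ⟨b, hb, hbS, h1, h2⟩
    · rw [he, dist_self]; positivity
    · exact (hBs b hb hbS).2.dist_le_of_mem_thickening h2.2 h1.2
  have hd : ∀ x, dist (k (Φ (ψ x))) (Φ x) ≤ α' + β + 4 * δ := fun x => by
    have h1 := hk1 (Φ (ψ x))
    have h2 := hψ2 x
    have h3 := dist_triangle (k (Φ (ψ x))) (Φ (ψ x)) (Φ x)
    linarith
  refine ⟨(ψ.trans Φ).trans k, S', hm, hSS', hS, fun a ha haS => ⟨hsmall a ha haS, ?_⟩,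
    fun b hb hbS => ?_, hd, fun y => ?_⟩
  · rintro _ ⟨x, hx, rfl⟩ _ ⟨y, hy, rfl⟩
    change dist (k (Φ (ψ x))) (k (Φ (ψ y))) ≤ _
    have h1 := (hAs a ha (haS.mono_right hSS')).2 _ (mem_image_of_mem _ hx) _
      (mem_image_of_mem _ hy)
    have h2 := hd x
    have h3 := hd y
    have h4 := dist_triangle4_right (k (Φ (ψ x))) (k (Φ (ψ y))) (Φ x) (Φ y)
    linarith
  · have hbS' : Disjoint b (⇑Φ '' S) := by
      refine hbS.mono_right ?_
      rintro _ ⟨x, hx, rfl⟩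
      exact ⟨x, hSS' hx, hS x hx⟩
    refine ⟨(hBs b hb hbS').1, ?_⟩
    have hmem : ∀ y ∈ b, ψ (((ψ.trans Φ).trans k).symm y) ∈ (fun x => k (Φ x)) ⁻¹' b := by
      intro y hy
      change ((ψ.trans Φ).trans k) (((ψ.trans Φ).trans k).symm y) ∈ b
      rwa [Homeomorph.apply_symm_apply]
    rintro _ ⟨x, hx, rfl⟩ _ ⟨y, hy, rfl⟩
    have h1 := hpre b hb hbS' _ (hmem x hx) _ (hmem y hy)
    have h2 := hψ1 (((ψ.trans Φ).trans k).symm x)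
    have h3 := hψ1 (((ψ.trans Φ).trans k).symm y)
    rw [dist_comm] at h2 h3
    have h4 := dist_triangle4_right (((ψ.trans Φ).trans k).symm x)
      (((ψ.trans Φ).trans k).symm y) (ψ (((ψ.trans Φ).trans k).symm x))
      (ψ (((ψ.trans Φ).trans k).symm y))
    linarith
  · obtain ⟨x, rfl⟩ := ((ψ.trans Φ).trans k).surjective y
    rw [Homeomorph.symm_apply_apply]
    change dist x (Φ.symm (k (Φ (ψ x)))) ≤ _
    have h1 := hψ1 x
    have h2 := hk2 (Φ (ψ x))
    rw [Φ.symm_apply_apply] at h2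
    have h3 := dist_triangle_left x (Φ.symm (k (Φ (ψ x)))) (ψ x)
    rw [dist_comm (ψ x) (Φ.symm _)] at h3
    linarith

/-- A matching homeomorphism whose unmatched pieces and their images (in both directions)
have diameter of order `ε`. -/
structure ControlledMatch {X : Type*} [MetricSpace X] (A B : Decomposition X) (ε : ℝ)
    (Φ : X ≃ₜ X) (S : Set X) : Prop where
  matches_ : Matches A B Φ S
  left : SmallOff A Φ S ε (62 * ε)
  right : SmallOff B Φ.symm (⇑Φ '' S) ε (62 * ε)

theorem ControlledMatch.exists_halve {X : Type*} [MetricSpace X] {𝒦 : Set (Set X)}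
    (h𝒦 : IsTameFamily 𝒦) {A B : Decomposition X} (hA : A.KTame 𝒦) (hAd : A.IsDenseDecomp)
    (hB : B.KTame 𝒦) (hBd : B.IsDenseDecomp) {Φ : X ≃ₜ X} {S : Set X} {ε : ℝ} (hε : 0 < ε)
    (h : ControlledMatch A B ε Φ S) :
    ∃ (Φ' : X ≃ₜ X) (S' : Set X), ControlledMatch A B (ε / 2) Φ' S' ∧ S ⊆ S' ∧
      (∀ x ∈ S, Φ' x = Φ x) ∧ (∀ x, dist (Φ' x) (Φ x) ≤ 268 * ε) ∧
      ∀ y, dist (Φ'.symm y) (Φ.symm y) ≤ 268 * ε := by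
  obtain ⟨Φ₁, S₁, hm₁, hS₁, he₁, hA₁, hB₁, hd₁, hd₁'⟩ := h.matches_.exists_extend_of_smallOff
    h𝒦 hA hB hBd (half_pos hε) hε.le (by positivity) hε.le (by positivity) h.left h.right
  have hA₁' : SmallOff A Φ₁.symm.symm (⇑Φ₁.symm '' (⇑Φ₁ '' S₁)) (ε / 2)
      (62 * ε + 2 * (62 * ε + ε + 4 * (ε / 2))) := by
    rw [Φ₁.symm_image_image]
    exact hA₁
  obtain ⟨Φ₂, S₂, hm₂, hS₂, he₂, hB₂, hA₂, hd₂, hd₂'⟩ :=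
    hm₁.symm.exists_extend_of_smallOff h𝒦 hB hA hAd (half_pos hε) hε.le (by positivity)
      (half_pos hε).le (by positivity) hB₁ hA₁'
  have himg : ∀ x ∈ S₁, Φ₂.symm x = Φ₁ x := by
    intro x hx
    rw [Homeomorph.symm_apply_eq, he₂ _ (mem_image_of_mem _ hx), Φ₁.symm_apply_apply]
  refine ⟨Φ₂.symm, ⇑Φ₂ '' S₂, ⟨hm₂.symm, hA₂.mono le_rfl (by linarith), ?_⟩, ?_, ?_, ?_, ?_⟩
  · rw [Φ₂.symm_image_image]
    exact hB₂.mono le_rfl (by linarith)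
  · intro x hx
    have hx₁ := hS₁ hx
    exact ⟨Φ₁ x, hS₂ (mem_image_of_mem _ hx₁), by rw [← himg x hx₁, Φ₂.apply_symm_apply]⟩
  · intro x hx
    rw [himg x (hS₁ hx), he₁ x hx]
  · intro x
    have h1 := hd₁ x
    have h2 := hd₂' x
    change dist (Φ₂.symm x) (Φ₁ x) ≤ _ at h2
    have h3 := dist_triangle (Φ₂.symm x) (Φ₁ x) (Φ x)
    linarith
  · intro y
    have h1 := hd₁' y
    have h2 := hd₂ y
    change dist (Φ₂ y) (Φ.symm y) ≤ _
    have h3 := dist_triangle (Φ₂ y) (Φ₁.symm y) (Φ.symm y)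
    linarith

/-- Every point and its image under `g` are joined by a chain of a piece of `A` and a
piece of `B`, up to the error `η`. -/
def ChainClose {X : Type*} [MetricSpace X] (A B : Decomposition X) (η : ℝ) (g : X → X) :
    Prop :=
  ∀ z, ∃ a ∈ A.pieces, ∃ b ∈ B.pieces, ∃ y, z ∈ Metric.thickening η a ∧
    y ∈ Metric.thickening η a ∧ y ∈ Metric.thickening η b ∧ g z ∈ Metric.thickening η b

theorem mem_thickening_add {X : Type*} [MetricSpace X] {a : Set X} {η τ : ℝ} {x y : X}
    (hx : x ∈ Metric.thickening η a) (hxy : dist y x ≤ τ) :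
    y ∈ Metric.thickening (η + τ) a := by
  obtain ⟨p, hp, hxp⟩ := Metric.mem_thickening_iff.1 hx
  refine Metric.mem_thickening_iff.2 ⟨p, hp, ?_⟩
  have := dist_triangle y x p
  linarith

theorem ChainClose.of_dist_le {X : Type*} [MetricSpace X] {A B : Decomposition X} {η τ : ℝ}
    {f g : X → X} (h : ChainClose A B η f) (hτ : 0 ≤ τ) (hg : ∀ x, dist (g x) (f x) ≤ τ) :
    ChainClose A B (η + τ) g := by
  intro z
  obtain ⟨a, ha, b, hb, y, h1, h2, h3, h4⟩ := h z
  have hle : η ≤ η + τ := by linarith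
  exact ⟨a, ha, b, hb, y, Metric.thickening_mono hle _ h1, Metric.thickening_mono hle _ h2,
    Metric.thickening_mono hle _ h3, mem_thickening_add h4 (hg z)⟩

theorem ChainClose.comp {X : Type*} [MetricSpace X] {A B : Decomposition X} {η τ : ℝ}
    {f g : X → X} (h : ChainClose A B η f) (hτ : 0 ≤ τ) (hg : ∀ x, dist x (g x) ≤ τ) :
    ChainClose A B (η + τ) fun x => f (g x) := by
  intro z
  obtain ⟨a, ha, b, hb, y, h1, h2, h3, h4⟩ := h (g z)
  have hle : η ≤ η + τ := by linarith
  exact ⟨a, ha, b, hb, y, mem_thickening_add h1 (hg z), Metric.thickening_mono hle _ h2,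
    Metric.thickening_mono hle _ h3, Metric.thickening_mono hle _ h4⟩

/-- Open neighborhoods of the pieces, pairwise disjoint for the pieces which are not small. -/
theorem Decomposition.Vanishing.exists_neighborhoods {X : Type*} [MetricSpace X]
    {D : Decomposition X} (hD : D.Vanishing) {δ : ℝ} (hδ : 0 < δ) :
    ∃ H : Set X → Set X, (∀ b ∈ D.pieces, IsOpen (H b)) ∧ (∀ b ∈ D.pieces, b ⊆ H b) ∧
      (∀ b ∈ D.pieces, H b ⊆ Metric.thickening δ b) ∧
      ∀ b ∈ D.pieces, ∀ b' ∈ D.pieces, ¬ SmallSet δ b → ¬ SmallSet δ b' →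
        ∀ x ∈ H b, x ∈ H b' → b = b' := by
  classical
  obtain ⟨E, hEo, haE, hEN, hE⟩ := (hD.discreteFamily_not_small hδ
    fun _ => True).exists_open_expansion (N := fun a => Metric.thickening δ a.1)
      (fun a => Metric.isOpen_thickening) (fun a => Metric.self_subset_thickening hδ _)
  let H : Set X → Set X := fun b =>
    if h : b ∈ D.pieces ∧ ¬ SmallSet δ b ∧ True then E ⟨b, h⟩ else Metric.thickening δ b
  have H1 : ∀ b (h : b ∈ D.pieces ∧ ¬ SmallSet δ b ∧ True), H b = E ⟨b, h⟩ := fun b h =>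
    dif_pos h
  have H2 : ∀ b, ¬ (b ∈ D.pieces ∧ ¬ SmallSet δ b ∧ True) → H b = Metric.thickening δ b :=
    fun b h => dif_neg h
  refine ⟨H, fun b _ => ?_, fun b _ => ?_, fun b _ => ?_, fun b hb b' hb' hs hs' x hx hx' => ?_⟩
  · by_cases h : b ∈ D.pieces ∧ ¬ SmallSet δ b ∧ True
    · rw [H1 b h]; exact hEo _
    · rw [H2 b h]; exact Metric.isOpen_thickening
  · by_cases h : b ∈ D.pieces ∧ ¬ SmallSet δ b ∧ True
    · rw [H1 b h]; exact haE ⟨b, h⟩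
    · rw [H2 b h]; exact Metric.self_subset_thickening hδ b
  · by_cases h : b ∈ D.pieces ∧ ¬ SmallSet δ b ∧ True
    · rw [H1 b h]; exact hEN ⟨b, h⟩
    · rw [H2 b h]
  · rw [H1 b ⟨hb, hs, trivial⟩] at hx
    rw [H1 b' ⟨hb', hs', trivial⟩] at hx'
    exact (congrArg Subtype.val (hE.eq_of_mem hx' hx)).symm

/-- Making the preimages of the unmatched pieces of `B` small, when the unmatched pieces of
`A` and `B` are already small. -/
theorem Matches.exists_small_preimage {X : Type*} [MetricSpace X] {𝒦 : Set (Set X)}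
    (h𝒦 : IsTameFamily 𝒦) {A B : Decomposition X} (hA : A.KTame 𝒦) (hB : B.KTame 𝒦)
    (hBd : B.IsDenseDecomp) {Φ : X ≃ₜ X} {S : Set X} (h : Matches A B Φ S) {δ : ℝ}
    (hδ : 0 < δ) (hAs : ∀ a ∈ A.pieces, Disjoint a S → SmallSet δ a)
    (hBs : ∀ b ∈ B.pieces, Disjoint b (⇑Φ '' S) → SmallSet δ b) :
    ∃ (Φ' : X ≃ₜ X) (S' : Set X), Matches A B Φ' S' ∧ S ⊆ S' ∧ (∀ x ∈ S, Φ' x = Φ x) ∧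
      (∀ x, dist (Φ' x) (Φ x) ≤ 3 * δ) ∧
      ∀ b ∈ B.pieces, Disjoint b (⇑Φ' '' S') → SmallSet δ b ∧ SmallSet δ (⇑Φ'.symm '' b) := by
  obtain ⟨k, ψ, S', hm, hSS', hS, hk, hψ, hpre, -⟩ := h.exists_extend h𝒦 hA hB hBd hδ
    (Metric.thickening δ) (Metric.thickening δ)
    (fun a _ => Metric.isOpen_thickening) (fun a _ => Metric.self_subset_thickening hδ a)
    (fun a _ => Metric.isOpen_thickening) (fun a _ => Metric.self_subset_thickening hδ a)
  have hψ' : ∀ x, ψ x = x := fun x => by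
    rcases hψ x with he | ⟨a, ha, haS, hb, -⟩
    · exact he
    · exact absurd (hAs a ha haS) hb
  have hΦ' : ∀ x, ((ψ.trans Φ).trans k) x = k (Φ x) := fun x => by
    change k (Φ (ψ x)) = _
    rw [hψ']
  refine ⟨(ψ.trans Φ).trans k, S', hm, hSS', hS, fun x => ?_, fun b hb hbS => ?_⟩
  · rw [hΦ']
    rcases hk (Φ x) with he | ⟨b, hb, hbS, h1, h2⟩
    · rw [he, dist_self]; positivity
    · have := (hBs b hb hbS).dist_le_of_mem_thickening h2 h1
      linarith
  · have hbS' : Disjoint b (⇑Φ '' S) := by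
      refine hbS.mono_right ?_
      rintro _ ⟨x, hx, rfl⟩
      exact ⟨x, hSS' hx, hS x hx⟩
    refine ⟨hBs b hb hbS', ?_⟩
    have hmem : ∀ y ∈ b, ((ψ.trans Φ).trans k).symm y ∈ (fun x => k (Φ x)) ⁻¹' b := by
      intro y hy
      rw [mem_preimage, ← hΦ', Homeomorph.apply_symm_apply]
      exact hy
    rintro _ ⟨x, hx, rfl⟩ _ ⟨y, hy, rfl⟩
    exact hpre b hb hbS' _ (hmem x hx) _ (hmem y hy)

/-- The initial step: matching all the pieces of diameter greater than `δ`. -/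
theorem exists_chainClose_match {X : Type*} [MetricSpace X] {𝒦 : Set (Set X)}
    (h𝒦 : IsTameFamily 𝒦) {A B : Decomposition X} (hA : A.KTame 𝒦) (hAd : A.IsDenseDecomp)
    (hB : B.KTame 𝒦) (hBd : B.IsDenseDecomp) {δ : ℝ} (hδ : 0 < δ) :
    ∃ (Φ : X ≃ₜ X) (S : Set X), Matches A B Φ S ∧ ChainClose A B (4 * δ) Φ ∧
      (∀ a ∈ A.pieces, Disjoint a S → SmallSet δ a) ∧
      ∀ b ∈ B.pieces, Disjoint b (⇑Φ '' S) → SmallSet δ b := by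
  obtain ⟨H, hHo, hbH, hHδ, hHd⟩ := hB.1.exists_neighborhoods hδ
  have h0 : Matches A B (Homeomorph.refl X) ∅ := by
    refine ⟨isClosed_empty, fun a _ h => ?_, fun a ha h => ?_⟩
    · simp at h
    · exact absurd (A.nonempty' a ha) (by rw [subset_empty_iff.1 h]; exact not_nonempty_empty)
  obtain ⟨k, ψ, S₁, hm₁, -, -, hk, hψ, -, hsA⟩ := h0.exists_extend h𝒦 hA hB hBd hδ
    (Metric.thickening δ) H
    (fun a _ => Metric.isOpen_thickening) (fun a _ => Metric.self_subset_thickening hδ a)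
    hHo hbH
  set Φ₁ := (ψ.trans (Homeomorph.refl X)).trans k with hΦ₁
  have hchain : ∀ z, ∃ a ∈ A.pieces, ∃ b ∈ B.pieces, ∃ y, z ∈ Metric.thickening δ a ∧
      y ∈ Metric.thickening δ a ∧ y ∈ H b ∧ Φ₁ z ∈ H b := by
    intro z
    have h1 : ∃ a ∈ A.pieces, z ∈ Metric.thickening δ a ∧ ψ z ∈ Metric.thickening δ a := by
      rcases hψ z with he | ⟨a, ha, -, -, h1, h2⟩
      · obtain ⟨a, ha, hza⟩ := A.covers z
        rw [he]
        exact ⟨a, ha, Metric.self_subset_thickening hδ a hza,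
          Metric.self_subset_thickening hδ a hza⟩
      · exact ⟨a, ha, h1, h2⟩
    have h2 : ∃ b ∈ B.pieces, ψ z ∈ H b ∧ k (ψ z) ∈ H b := by
      rcases hk (ψ z) with he | ⟨b, hb, -, h1, h2⟩
      · obtain ⟨b, hb, hzb⟩ := B.covers (ψ z)
        rw [he]
        exact ⟨b, hb, hbH b hb hzb, hbH b hb hzb⟩
      · exact ⟨b, hb, h1, h2⟩
    obtain ⟨a, ha, h1, h1'⟩ := h1
    obtain ⟨b, hb, h2, h2'⟩ := h2
    exact ⟨a, ha, b, hb, ψ z, h1, h1', h2, h2'⟩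
  obtain ⟨k₂, ψ₂, S₂, hm₂, hS₂, he₂, hk₂, hψ₂, -, hsB⟩ := hm₁.symm.exists_extend h𝒦 hB hA hAd hδ
    H (Metric.thickening δ) hHo hbH
    (fun a _ => Metric.isOpen_thickening) (fun a _ => Metric.self_subset_thickening hδ a)
  rw [Φ₁.symm_image_image] at hk₂
  set Φ₂ := (ψ₂.trans Φ₁.symm).trans k₂ with hΦ₂
  refine ⟨Φ₂.symm, ⇑Φ₂ '' S₂, hm₂.symm, fun z => ?_, fun a ha haS => ?_, ?_⟩
  · obtain ⟨u, rfl⟩ := Φ₂.surjective z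
    rw [Φ₂.symm_apply_apply]
    set w := Φ₁.symm (ψ₂ u) with hw
    have hΦ₁w : Φ₁ w = ψ₂ u := Φ₁.apply_symm_apply _
    have hd : dist (k₂ w) w ≤ 3 * δ := by
      rcases hk₂ w with he | ⟨a, ha, haS, h1, h2⟩
      · rw [he, dist_self]; positivity
      · have := (hsA a ha haS).dist_le_of_mem_thickening h2 h1
        linarith
    obtain ⟨a, ha, b, hb, y, h1, h2, h3, h4⟩ := hchain w
    rw [hΦ₁w] at h4
    have hz : Φ₂ u ∈ Metric.thickening (4 * δ) a := by
      have := mem_thickening_add h1 hd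
      rwa [show δ + 3 * δ = 4 * δ by ring] at this
    have hle : δ ≤ 4 * δ := by linarith
    have hy := Metric.thickening_mono hle _ h2
    by_cases hub : u ∈ H b
    · exact ⟨a, ha, b, hb, y, hz, hy, Metric.thickening_mono hle _ (hHδ b hb h3),
        Metric.thickening_mono hle _ (hHδ b hb hub)⟩
    · rcases hψ₂ u with he | ⟨b', hb', -, hbig, h5, h6⟩
      · rw [he] at h4
        exact absurd h4 hub
      · have hsm : SmallSet δ b := by
          by_contra hbig'
          rw [hHd b hb b' hb' hbig' hbig _ h4 h6] at hub
          exact hub h5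
        have hyd := hsm.dist_le_of_mem_thickening (hHδ b hb h3) (hHδ b hb h4)
        have := mem_thickening_add (hHδ b' hb' h6) hyd
        rw [show δ + (δ + 2 * δ) = 4 * δ by ring] at this
        exact ⟨a, ha, b', hb', y, hz, hy, this,
          Metric.thickening_mono hle _ (hHδ b' hb' h5)⟩
  · refine hsA a ha (haS.mono_right fun x hx => ?_)
    have hx' := mem_image_of_mem Φ₁ hx
    refine ⟨Φ₁ x, hS₂ hx', ?_⟩
    change k₂ (Φ₁.symm (ψ₂ (Φ₁ x))) = x
    rw [he₂ _ hx', Φ₁.symm_apply_apply]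
  · rw [Φ₂.symm_image_image]
    exact hsB

/-- The initial controlled match. -/
theorem exists_controlledMatch {X : Type*} [MetricSpace X] {𝒦 : Set (Set X)}
    (h𝒦 : IsTameFamily 𝒦) {A B : Decomposition X} (hA : A.KTame 𝒦) (hAd : A.IsDenseDecomp)
    (hB : B.KTame 𝒦) (hBd : B.IsDenseDecomp) {δ : ℝ} (hδ : 0 < δ) :
    ∃ (Φ : X ≃ₜ X) (S : Set X), ControlledMatch A B δ Φ S ∧ ChainClose A B (10 * δ) Φ := by
  obtain ⟨Φ₀, S₀, hm₀, hc₀, hA₀, hB₀⟩ := exists_chainClose_match h𝒦 hA hAd hB hBd hδ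
  obtain ⟨Φ₁, S₁, hm₁, hS₁, he₁, hd₁, hB₁⟩ :=
    hm₀.exists_small_preimage h𝒦 hA hB hBd hδ hA₀ hB₀
  have hA₁ : ∀ a ∈ A.pieces, Disjoint a S₁ → SmallSet δ a := fun a ha haS =>
    hA₀ a ha (haS.mono_right hS₁)
  obtain ⟨Φ₂, S₂, hm₂, hS₂, he₂, hd₂, hA₂⟩ :=
    hm₁.symm.exists_small_preimage h𝒦 hB hA hAd hδ (fun b hb hbS => (hB₁ b hb hbS).1)
      (by rw [Φ₁.symm_image_image]; exact hA₁)
  refine ⟨Φ₂.symm, ⇑Φ₂ '' S₂, ⟨hm₂.symm, fun a ha haS => ?_, ?_⟩, ?_⟩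
  · exact ⟨(hA₂ a ha haS).1, (hA₂ a ha haS).2.mono (by linarith)⟩
  · rw [Φ₂.symm_image_image]
    intro b hb hbS
    obtain ⟨h1, h2⟩ := hB₁ b hb (hbS.mono_right hS₂)
    refine ⟨h1, ?_⟩
    rintro _ ⟨x, hx, rfl⟩ _ ⟨y, hy, rfl⟩
    change dist (Φ₂ x) (Φ₂ y) ≤ _
    have h3 := h2 _ (mem_image_of_mem _ hx) _ (mem_image_of_mem _ hy)
    have h4 := hd₂ x
    have h5 := hd₂ y
    have h6 := dist_triangle4_right (Φ₂ x) (Φ₂ y) (Φ₁.symm x) (Φ₁.symm y)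
    linarith
  · have h1 := hc₀.of_dist_le (by positivity) hd₁
    have h2 : ChainClose A B (4 * δ + 3 * δ + 3 * δ) fun x => Φ₁ (Φ₁.symm (Φ₂.symm x)) :=
      h1.comp (g := fun x => Φ₁.symm (Φ₂.symm x)) (by positivity) fun x => by
        have := hd₂ (Φ₂.symm x)
        rwa [Φ₂.apply_symm_apply] at this
    have h3 : (fun x => Φ₁ (Φ₁.symm (Φ₂.symm x))) = ⇑Φ₂.symm := by
      ext x
      exact Φ₁.apply_symm_apply _
    rw [h3] at h2
    convert h2 using 1
    ring


open Filter in
theorem exists_continuous_limit {X : Type*} [MetricSpace X] [CompleteSpace X] {f : ℕ → X → X}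
    (hf : ∀ n, Continuous (f n)) {C : ℝ}
    (hd : ∀ n x, dist (f (n + 1) x) (f n x) ≤ C / 2 / 2 ^ n) :
    ∃ g : X → X, Continuous g ∧ TendstoUniformly f g atTop ∧ ∀ x, dist (g x) (f 0 x) ≤ C := by
  have hd' : ∀ x n, dist (f n x) (f (n + 1) x) ≤ C / 2 / 2 ^ n := fun x n => by
    rw [dist_comm]
    exact hd n x
  choose g hg using fun x => cauchySeq_tendsto_of_complete (cauchySeq_of_le_geometric_two (hd' x))
  have hu : TendstoUniformly f g atTop := by
    rw [Metric.tendstoUniformly_iff]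
    intro ε hε
    have h0 : Tendsto (fun n : ℕ => C * (1 / 2 : ℝ) ^ n) atTop (𝓝 (C * 0)) :=
      (tendsto_pow_atTop_nhds_zero_of_lt_one (by norm_num) (by norm_num)).const_mul C
    rw [mul_zero] at h0
    filter_upwards [h0.eventually_lt_const hε] with n hn x
    have h1 := dist_le_of_le_geometric_two_of_tendsto (hd' x) (hg x) n
    rw [dist_comm]
    refine h1.trans_lt ?_
    rwa [div_eq_mul_one_div, ← one_div_pow]
  refine ⟨g, hu.continuous (Frequently.of_forall hf), hu, fun x => ?_⟩
  rw [dist_comm]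
  exact dist_le_of_le_geometric_two_of_tendsto₀ (hd' x) (hg x)

open Filter in
/-- A sequence of homeomorphisms which converges fast, together with the inverses, converges
to a homeomorphism. -/
theorem Homeomorph.exists_limit {X : Type*} [MetricSpace X] [CompleteSpace X] {Φ : ℕ → X ≃ₜ X}
    {C : ℝ} (hd : ∀ n x, dist (Φ (n + 1) x) (Φ n x) ≤ C / 2 / 2 ^ n)
    (hd' : ∀ n x, dist ((Φ (n + 1)).symm x) ((Φ n).symm x) ≤ C / 2 / 2 ^ n) :
    ∃ Ψ : X ≃ₜ X, (∀ x, Tendsto (fun n => Φ n x) atTop (𝓝 (Ψ x))) ∧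
      ∀ x, dist (Ψ x) (Φ 0 x) ≤ C := by
  obtain ⟨f, hf, hfu, hf0⟩ := exists_continuous_limit (fun n => (Φ n).continuous) hd
  obtain ⟨g, hg, hgu, -⟩ := exists_continuous_limit (fun n => (Φ n).symm.continuous) hd'
  have h1 : ∀ x, g (f x) = x := fun x => by
    have := hgu.tendsto_comp hg.continuousAt (hfu.tendsto_at x)
    simp only [Homeomorph.symm_apply_apply] at this
    exact tendsto_nhds_unique this tendsto_const_nhds
  have h2 : ∀ x, f (g x) = x := fun x => by
    have := hfu.tendsto_comp hf.continuousAt (hgu.tendsto_at x)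
    simp only [Homeomorph.apply_symm_apply] at this
    exact tendsto_nhds_unique this tendsto_const_nhds
  exact ⟨⟨⟨f, g, h1, h2⟩, hf, hg⟩, fun x => hfu.tendsto_at x, hf0⟩

theorem exists_matching_limit {X : Type*} [MetricSpace X] [CompleteSpace X] {𝒦 : Set (Set X)}
    (h𝒦 : IsTameFamily 𝒦) {A B : Decomposition X} (hA : A.KTame 𝒦) (hAd : A.IsDenseDecomp)
    (hB : B.KTame 𝒦) (hBd : B.IsDenseDecomp) {δ : ℝ} (hδ : 0 < δ) :
    ∃ Ψ : X ≃ₜ X, (fun S : Set X => ⇑Ψ '' S) '' A.pieces = B.pieces ∧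
      ChainClose A B (546 * δ) Ψ := by
  obtain ⟨Φ₀, S₀, h₀, hc₀⟩ := exists_controlledMatch h𝒦 hA hAd hB hBd hδ
  have hpos : ∀ n : ℕ, 0 < δ / 2 ^ n := fun n => by positivity
  let T : ℕ → Type _ := fun n =>
    {p : (X ≃ₜ X) × Set X // ControlledMatch A B (δ / 2 ^ n) p.1 p.2}
  have hstep : ∀ n (p : T n), ∃ p' : T (n + 1), p.1.2 ⊆ p'.1.2 ∧
      (∀ x ∈ p.1.2, p'.1.1 x = p.1.1 x) ∧
      (∀ x, dist (p'.1.1 x) (p.1.1 x) ≤ 268 * (δ / 2 ^ n)) ∧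
      ∀ y, dist (p'.1.1.symm y) (p.1.1.symm y) ≤ 268 * (δ / 2 ^ n) := by
    rintro n ⟨⟨Φ, S⟩, h⟩
    obtain ⟨Φ', S', h', hrest⟩ := h.exists_halve h𝒦 hA hAd hB hBd (hpos n)
    rw [div_div, ← pow_succ] at h'
    exact ⟨⟨⟨Φ', S'⟩, h'⟩, hrest⟩
  choose next hnext using hstep
  let s : ∀ n, T n := fun n =>
    Nat.rec (motive := T) ⟨⟨Φ₀, S₀⟩, by simpa using h₀⟩ next n
  have hs : ∀ n, s (n + 1) = next n (s n) := fun _ => rfl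
  have hmono : Monotone fun n => (s n).1.2 := monotone_nat_of_le_succ fun n => by
    rw [hs]; exact (hnext n (s n)).1
  have heq : ∀ n k, ∀ x ∈ (s n).1.2, (s (n + k)).1.1 x = (s n).1.1 x := by
    intro n k x hx
    induction k with
    | zero => rfl
    | succ k ih =>
      rw [← ih, ← add_assoc, hs]
      exact (hnext _ _).2.1 x (hmono (Nat.le_add_right n k) hx)
  have hC : ∀ n : ℕ, 268 * (δ / 2 ^ n) = 536 * δ / 2 / 2 ^ n := fun n => by ring
  obtain ⟨Ψ, hΨ, hΨ0⟩ := Homeomorph.exists_limit (Φ := fun n => (s n).1.1) (C := 536 * δ)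
    (fun n x => by rw [← hC, hs]; exact (hnext n (s n)).2.2.1 x)
    (fun n x => by rw [← hC, hs]; exact (hnext n (s n)).2.2.2 x)
  have hΨS : ∀ n, ∀ x ∈ (s n).1.2, Ψ x = (s n).1.1 x := by
    intro n x hx
    refine tendsto_nhds_unique (hΨ x) (tendsto_const_nhds.congr' ?_)
    filter_upwards [Filter.eventually_ge_atTop n] with m hm
    obtain ⟨k, rfl⟩ := Nat.exists_eq_add_of_le hm
    exact (heq n k x hx).symm
  have himg : ∀ n, ∀ a ⊆ (s n).1.2, ⇑Ψ '' a = ⇑(s n).1.1 '' a := fun n a ha =>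
    image_congr fun x hx => hΨS n x (ha hx)
  have hsmall : ∀ a : Set X, ¬ a.Subsingleton → ∃ n : ℕ, ¬ SmallSet (δ / 2 ^ n) a := by
    intro a ha
    obtain ⟨x, hx, y, hy, hxy⟩ := not_subsingleton_iff.1 ha
    obtain ⟨n, hn⟩ := exists_pow_lt_of_lt_one (div_pos (dist_pos.2 hxy) hδ)
      (show (1 / 2 : ℝ) < 1 by norm_num)
    refine ⟨n, fun h => absurd (h x hx y hy) (not_le.2 ?_)⟩
    rw [lt_div_iff₀ hδ] at hn
    rwa [div_eq_mul_one_div, ← one_div_pow, mul_comm]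
  have hmemA : ∀ a ∈ A.pieces, ¬ a.Subsingleton → ⇑Ψ '' a ∈ B.pieces := by
    intro a ha hns
    obtain ⟨n, hn⟩ := hsmall a hns
    have hne : (a ∩ (s n).1.2).Nonempty := by
      rw [← not_disjoint_iff_nonempty_inter]
      exact fun h => hn ((s n).2.left a ha h).1
    have haS := (s n).2.matches_.saturated a ha hne
    rw [himg n a haS]
    exact (s n).2.matches_.image_mem a ha haS
  have hmemB : ∀ b ∈ B.pieces, ¬ b.Subsingleton → ∃ a ∈ A.pieces, ⇑Ψ '' a = b := by
    intro b hb hns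
    obtain ⟨n, hn⟩ := hsmall b hns
    have hne : (b ∩ ⇑(s n).1.1 '' (s n).1.2).Nonempty := by
      rw [← not_disjoint_iff_nonempty_inter]
      exact fun h => hn ((s n).2.right b hb h).1
    obtain ⟨a, ha, haS, hab⟩ := (s n).2.matches_.exists_image_eq hb hne
    exact ⟨a, ha, by rw [himg n a haS, hab]⟩
  have hmem : ∀ a ∈ A.pieces, ⇑Ψ '' a ∈ B.pieces := by
    intro a ha
    by_cases hns : a.Subsingleton
    · obtain ⟨x, hx⟩ := A.nonempty' a ha
      obtain ⟨b, hb, hxb⟩ := B.covers (Ψ x)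
      have himgb : ⇑Ψ '' a ⊆ b := by
        rintro _ ⟨y, hy, rfl⟩
        rwa [hns hy hx]
      by_cases hbs : b.Subsingleton
      · rwa [himgb.antisymm fun y hy => ⟨x, hx, hbs hxb hy⟩]
      · obtain ⟨a', ha', rfl⟩ := hmemB b hb hbs
        obtain ⟨x', hx', he⟩ := hxb
        rw [Ψ.injective he] at hx'
        rwa [A.eq_of_mem ha ha' hx hx']
    · exact hmemA a ha hns
  refine ⟨Ψ, Subset.antisymm (image_subset_iff.2 hmem) fun b hb => ?_, ?_⟩
  · obtain ⟨y, hy⟩ := B.nonempty' b hb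
    obtain ⟨a, ha, hxa⟩ := A.covers (Ψ.symm y)
    exact ⟨a, ha, B.eq_of_mem (hmem a ha) hb ⟨_, hxa, Ψ.apply_symm_apply y⟩ hy⟩
  · have := hc₀.of_dist_le (by positivity) hΨ0
    rwa [show 10 * δ + 536 * δ = 546 * δ by ring] at this

theorem subset_covStar_of_forall_ball {X : Type*} [MetricSpace X] {𝒰 : Set (Set X)}
    (h𝒰 : ∀ x, ∃ u ∈ 𝒰, Metric.ball x 1 ⊆ u) (a : Set X) :
    Metric.thickening 1 a ⊆ covStar a 𝒰 := by
  intro x hx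
  obtain ⟨p, hp, hxp⟩ := Metric.mem_thickening_iff.1 hx
  obtain ⟨u, hu, hpu⟩ := h𝒰 p
  exact ⟨u, ⟨hu, p, hpu (Metric.mem_ball_self one_pos), hp⟩, hpu hxp⟩

theorem ChainClose.near {X : Type*} [MetricSpace X] {A B : Decomposition X} {𝒰 : Set (Set X)}
    {g : X → X} (hg : ChainClose A B 1 g) (h𝒰 : ∀ x, ∃ u ∈ 𝒰, Metric.ball x 1 ⊆ u) :
    Near g id {w : Set X | ∃ a ∈ A.pieces, ∃ b ∈ B.pieces,
      (covStar a 𝒰 ∩ covStar b 𝒰).Nonempty ∧ w = covStar a 𝒰 ∪ covStar b 𝒰} := by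
  intro z _
  obtain ⟨a, ha, b, hb, y, h1, h2, h3, h4⟩ := hg z
  have hst := subset_covStar_of_forall_ball h𝒰
  exact ⟨_, ⟨a, ha, b, hb, ⟨y, hst a h2, hst b h3⟩, rfl⟩, Or.inr (hst b h4), Or.inl (hst a h1)⟩

theorem Topology.IsClosedEmbedding.completeSpace_comapMetricSpace {X Y : Type*}
    [TopologicalSpace X] [MetricSpace Y] [CompleteSpace Y] {f : X → Y} (hf : IsClosedEmbedding f) :
    @CompleteSpace X (hf.isEmbedding.comapMetricSpace f).toUniformSpace := by
  let m := hf.isEmbedding.comapMetricSpace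
  exact (completeSpace_iff_isComplete_range
    (Isometry.of_dist_eq (f := f) fun _ _ => rfl).isUniformInducing).2 hf.isClosed_range.isComplete

open scoped BoundedContinuousFunction in
/-- A completely metrizable space has a complete metric for which a given open cover has
Lebesgue number `1`. -/
theorem CompletelyMetrizable.exists_metric_ball_subset {X : Type*} [t : TopologicalSpace X]
    (hX : CompletelyMetrizable X) {𝒰 : Set (Set X)} (ho : ∀ u ∈ 𝒰, IsOpen u)
    (hc : ⋃₀ 𝒰 = univ) :
    ∃ m : MetricSpace X, m.toUniformSpace.toTopologicalSpace = t ∧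
      @CompleteSpace X m.toUniformSpace ∧ ∀ x, ∃ u ∈ 𝒰, Metric.ball x 1 ⊆ u := by
  obtain ⟨m, rfl, hm⟩ := hX
  obtain ⟨l, hl⟩ : ∃ l : C(X, ℝ), ∀ x, l x ∈ {r : ℝ | 0 < r ∧ ∃ u ∈ 𝒰, Metric.ball x r ⊆ u} := by
    refine exists_continuous_forall_mem_convex_of_local_const (fun x => ?_) fun x => ?_
    · refine Set.OrdConnected.convex ⟨fun r hr s hs q hq => ⟨hr.1.trans_le hq.1, ?_⟩⟩
      obtain ⟨-, u, hu, hsu⟩ := hs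
      exact ⟨u, hu, (Metric.ball_subset_ball hq.2).trans hsu⟩
    · obtain ⟨u, hu, hxu⟩ : x ∈ ⋃₀ 𝒰 := hc ▸ mem_univ x
      obtain ⟨ε, hε, hεu⟩ := Metric.isOpen_iff.1 (ho u hu) x hxu
      refine ⟨ε / 2, ?_⟩
      filter_upwards [Metric.ball_mem_nhds x (half_pos hε)] with y hy
      refine ⟨half_pos hε, u, hu, (Metric.ball_subset_ball' ?_).trans hεu⟩
      have := Metric.mem_ball.1 hy
      linarith
  have hl0 : ∀ x, 0 < l x := fun x => (hl x).1
  let F : X → X →ᵇ ℝ := fun x =>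
    BoundedContinuousFunction.ofNormedAddCommGroup (fun z => max 0 (l x - dist x z))
      (by fun_prop) (l x) fun z => by
        rw [Real.norm_of_nonneg (le_max_left _ _)]
        exact max_le (hl0 x).le (sub_le_self _ dist_nonneg)
  have hFa : ∀ x z, F x z = max 0 (l x - dist x z) := fun _ _ => rfl
  have hF : Continuous F := by
    refine continuous_iff_continuousAt.2 fun x => ?_
    have h0 : Filter.Tendsto (fun y => |l y - l x| + dist y x) (𝓝 x) (𝓝 0) := by
      have : Continuous fun y => |l y - l x| + dist y x := by fun_prop
      simpa using this.tendsto x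
    refine tendsto_iff_dist_tendsto_zero.2 (squeeze_zero (fun _ => dist_nonneg) (fun y => ?_) h0)
    refine (BoundedContinuousFunction.dist_le (by positivity)).2 fun z => ?_
    rw [hFa, hFa, Real.dist_eq]
    refine (abs_max_sub_max_le_max _ _ _ _).trans (max_le (by simp; positivity) ?_)
    have h1 := abs_dist_sub_le y x z
    have h2 := abs_sub (l y - l x) (dist y z - dist x z)
    rw [show l y - dist y z - (l x - dist x z) = l y - l x - (dist y z - dist x z) by ring]
    linarith
  let G : X → X →ᵇ ℝ := fun x => (l x)⁻¹ • F x
  have hG : Continuous G := (l.continuous.inv₀ fun x => (hl0 x).ne').smul hF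
  have hemb : IsClosedEmbedding fun x => (x, G x) := by
    refine ⟨isEmbedding_graph hG, ?_⟩
    have : range (fun x => (x, G x)) = {p : X × (X →ᵇ ℝ) | p.2 = G p.1} := by
      ext ⟨x, f⟩
      simp [Prod.ext_iff, eq_comm]
    rw [this]
    exact isClosed_eq continuous_snd (hG.comp continuous_fst)
  refine ⟨hemb.isEmbedding.comapMetricSpace _, rfl,
    hemb.completeSpace_comapMetricSpace, fun x => ?_⟩
  obtain ⟨-, u, hu, hxu⟩ := hl x
  refine ⟨u, hu, fun y hy => hxu ?_⟩
  have hy' : max (dist y x) (dist (G y) (G x)) < 1 := hy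
  have h1 := (BoundedContinuousFunction.dist_coe_le_dist (f := G y) (g := G x) y).trans_lt
    ((le_max_right _ _).trans_lt hy')
  have hGa : ∀ x z, G x z = (l x)⁻¹ * max 0 (l x - dist x z) := fun _ _ => rfl
  rw [hGa, hGa, dist_self, sub_zero, max_eq_right (hl0 y).le, inv_mul_cancel₀ (hl0 y).ne'] at h1
  by_contra hn
  have hn' : l x ≤ dist y x := not_lt.1 hn
  rw [dist_comm y x] at hn'
  rw [max_eq_left (by linarith), mul_zero] at h1
  simp at h1

/-- Corollary: two dense `𝒦`-tame decompositions of a strongly locally homogeneous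
completely metrizable space are topologically equivalent; moreover the equivalence can
be chosen `𝒲`-close to the identity. -/
theorem dense_KTame_topEquiv (X : Type*) [TopologicalSpace X]
    (hX : CompletelyMetrizable X) (hslh : StronglyLocallyHomogeneous X)
    (𝒦 : Set (Set X)) (h𝒦 : IsTameFamily 𝒦)
    (A B : Decomposition X) (hA : A.KTame 𝒦) (hAd : A.IsDenseDecomp)
    (hB : B.KTame 𝒦) (hBd : B.IsDenseDecomp) :
    TopEquivDecomp A B ∧
      ∀ 𝒰 : Set (Set X), (∀ u ∈ 𝒰, IsOpen u) → ⋃₀ 𝒰 = Set.univ →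
        ∃ Φ : X ≃ₜ X, (fun S : Set X => ⇑Φ '' S) '' A.pieces = B.pieces ∧
          Near ⇑Φ id {w : Set X | ∃ a ∈ A.pieces, ∃ b ∈ B.pieces,
            (covStar a 𝒰 ∩ covStar b 𝒰).Nonempty ∧ w = covStar a 𝒰 ∪ covStar b 𝒰} := by
  have key : ∀ 𝒰 : Set (Set X), (∀ u ∈ 𝒰, IsOpen u) → ⋃₀ 𝒰 = Set.univ →
      ∃ Φ : X ≃ₜ X, (fun S : Set X => ⇑Φ '' S) '' A.pieces = B.pieces ∧
        Near ⇑Φ id {w : Set X | ∃ a ∈ A.pieces, ∃ b ∈ B.pieces,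
          (covStar a 𝒰 ∩ covStar b 𝒰).Nonempty ∧ w = covStar a 𝒰 ∪ covStar b 𝒰} := by
    intro 𝒰 ho hc
    obtain ⟨m, rfl, hm, hball⟩ := hX.exists_metric_ball_subset ho hc
    obtain ⟨Φ, hΦ, hchain⟩ :=
      exists_matching_limit h𝒦 hA hAd hB hBd (δ := 1 / 546) (by norm_num)
    rw [show (546 : ℝ) * (1 / 546) = 1 by norm_num] at hchain
    exact ⟨Φ, hΦ, hchain.near hball⟩
  obtain ⟨Φ, hΦ, -⟩ := key {univ} (by simp) (by simp)
  exact ⟨⟨Φ, hΦ⟩, key⟩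

end
end

section
/- Let D be a vanishing decomposition of a metrizable space X, let U ⊆ X/D be an open neighborhood of the non-degeneracy part D° in the decomposition space X/D, and let V = q_D⁻¹(U) ⊆ X. Then there is an open cover U of U such that for every homeomorphism h : V → U with (h, q_D|V) ≺ U, the map h̄ : X → X/D defined by h̄(x) = h(x) for x ∈ V and h̄(x) = {x} otherwise is a homeomorphism of X onto the decomposition space X/D. -/
open Set Topology unitInterval

noncomputable section

namespace Decomposition

variable {X : Type*} [TopologicalSpace X] (D : Decomposition X)

theorem mem_q (x : X) : x ∈ (D.q x).1 := (D.covers x).choose_spec.2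

variable {D}

theorem eq_q {x : X} {B : D.Space} (hx : x ∈ B.1) : B = D.q x := by
  by_contra hne
  exact disjoint_left.1 (D.disjoint' _ B.2 _ (D.q x).2 fun h => hne (Subtype.ext h)) hx (D.mem_q x)

theorem exists_q_eq (B : D.Space) : ∃ x, D.q x = B :=
  (D.nonempty' _ B.2).imp fun _ hx => (eq_q hx).symm

theorem continuous_q : Continuous D.q := continuous_coinduced_rng

theorem coe_q_eq_singleton {x : X} (hx : D.q x ∉ D.nondeg) : (D.q x).1 = {x} :=
  (not_not.1 hx).eq_singleton_of_mem (D.mem_q x)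

theorem Vanishing.isUSC [T3Space X] (hD : D.Vanishing) : D.IsUSC := by
  intro F hF
  refine isOpen_compl_iff.1 (isOpen_iff_mem_nhds.2 fun x hx => ?_)
  have hdisj : ∀ A ∈ D.pieces, (A ∩ F).Nonempty → x ∉ A := fun A hA hAF hxA =>
    hx ⟨A, ⟨hA, hAF⟩, hxA⟩
  have hxF : x ∉ F := fun h => hdisj _ (D.q x).2 ⟨x, D.mem_q x, h⟩ (D.mem_q x)
  obtain ⟨N, N', hN, hN', hxN, hFN', hNN'⟩ :=
    SeparatedNhds.of_isCompact_isClosed (isCompact_singleton (x := x)) hF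
      (disjoint_singleton_left.2 hxF)
  obtain ⟨T, hT, hTD⟩ := hD {Fᶜ, N'}
    (by rintro u (rfl | rfl); exacts [hF.isOpen_compl, hN'])
    (eq_univ_of_forall fun y => by
      by_cases hy : y ∈ F
      · exact ⟨N', by simp, hFN' hy⟩
      · exact ⟨Fᶜ, by simp, hy⟩) x
  have hbig : ∀ A ∈ D.pieces, (A ∩ F).Nonempty → (N ∩ A).Nonempty →
      ∀ u ∈ ({Fᶜ, N'} : Set (Set X)), ¬ A ⊆ u := by
    rintro A - ⟨a, haA, haF⟩ ⟨b, hbN, hbA⟩ u (rfl | rfl) hAu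
    · exact hAu haA haF
    · exact disjoint_left.1 hNN' hbN (hAu hbA)
  have hTN : T ∩ N ∈ 𝓝 x := Filter.inter_mem hT (hN.mem_nhds (hxN rfl))
  by_cases hA : ∃ A ∈ D.pieces, (A ∩ F).Nonempty ∧ (T ∩ N ∩ A).Nonempty
  · obtain ⟨A, hA, hAF, y, ⟨hyT, hyN⟩, hyA⟩ := hA
    filter_upwards [hTN, (D.isCompact' A hA).isClosed.isOpen_compl.mem_nhds (hdisj A hA hAF)]
    rintro z ⟨hzT, hzN⟩ hzA ⟨B, ⟨hB, hBF⟩, hzB⟩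
    have := hTD A hA (hbig A hA hAF ⟨y, hyN, hyA⟩) B hB (hbig B hB hBF ⟨z, hzN, hzB⟩)
      ⟨y, hyT, hyA⟩ ⟨z, hzT, hzB⟩
    exact hzA (this ▸ hzB)
  · filter_upwards [hTN]
    rintro z hz ⟨B, ⟨hB, hBF⟩, hzB⟩
    exact hA ⟨B, hB, hBF, z, hz, hzB⟩

theorem IsUSC.isOpen_setOf_subset (hD : D.IsUSC) {O : Set X} (hO : IsOpen O) :
    IsOpen {B : D.Space | B.1 ⊆ O} := by
  refine isOpen_coinduced.2 ?_
  convert (hD Oᶜ hO.isClosed_compl).isOpen_compl using 1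
  ext x
  constructor
  · rintro h ⟨A, ⟨hA, a, haA, haO⟩, hxA⟩
    have hAq : (⟨A, hA⟩ : D.Space) = D.q x := eq_q hxA
    exact haO (h (hAq ▸ haA : a ∈ (D.q x).1))
  · intro h y hy
    by_contra hyO
    exact h ⟨_, ⟨(D.q x).2, y, hy, hyO⟩, D.mem_q x⟩

/-- There is an open cover of an open set containing all nondegenerate points whose members
shrink towards every point of the complement. -/
theorem IsUSC.exists_cover_shrinking [TopologicalSpace.MetrizableSpace X] (hD : D.IsUSC)
    {U : Set D.Space} (hU : IsOpen U) (hnd : D.nondeg ⊆ U) :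
    ∃ 𝒰 : Set (Set D.Space), (∀ u ∈ 𝒰, IsOpen u ∧ u ⊆ U) ∧ U ⊆ ⋃₀ 𝒰 ∧
      ∀ x : X, D.q x ∉ U → ∀ W ∈ 𝓝 (D.q x), ∃ W' ∈ 𝓝 (D.q x), W' ⊆ W ∧
        ∀ u ∈ 𝒰, (u ∩ W').Nonempty → u ⊆ W := by
  let := TopologicalSpace.metrizableSpaceMetric X
  let A : Set X := (D.q ⁻¹' U)ᶜ
  have hA : IsClosed A := (hU.preimage continuous_q).isClosed_compl
  let O : D.Space → Set X := fun P => ⋃ p ∈ P.1, Metric.eball p (Metric.infEDist p A / 2)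
  have hOopen (P : D.Space) : IsOpen (O P) :=
    isOpen_biUnion fun p _ => Metric.isOpen_eball
  have hO {P : D.Space} {z : X} (hz : z ∈ O P) {x : X} (hx : D.q x ∉ U) :
      ∃ p ∈ P.1, 2 * dist z p < dist p x := by
    obtain ⟨p, hp, hzp⟩ := mem_iUnion₂.1 hz
    refine ⟨p, hp, ?_⟩
    have h : edist z p < edist p x / 2 := (Metric.mem_eball.1 hzp).trans_le
      (ENNReal.div_le_div_right (Metric.infEDist_le_edist_of_mem hx) 2)
    rw [edist_dist, edist_dist, ← ENNReal.ofReal_ofNat 2,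
      ← ENNReal.ofReal_div_of_pos two_pos] at h
    linarith [(ENNReal.ofReal_lt_ofReal_iff_of_nonneg dist_nonneg).1 h]
  refine ⟨(fun P => U ∩ {B | B.1 ⊆ O P}) '' U, ?_, ?_, ?_⟩
  · rintro _ ⟨P, -, rfl⟩
    exact ⟨hU.inter (hD.isOpen_setOf_subset (hOopen P)), inter_subset_left⟩
  · refine fun P hP => ⟨_, mem_image_of_mem _ hP, hP, fun p hp => ?_⟩
    refine mem_iUnion₂.2 ⟨p, hp, Metric.mem_eball_self (ENNReal.half_pos ?_)⟩
    rw [← pos_iff_ne_zero, Metric.infEDist_pos_iff_notMem_closure, hA.closure_eq]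
    exact fun h => h (show D.q p ∈ U from eq_q hp ▸ hP)
  · intro x hx W hW
    have hqx : (D.q x).1 = {x} := coe_q_eq_singleton fun h => hx (hnd h)
    have hball {r : ℝ} (hr : 0 < r) : {B : D.Space | B.1 ⊆ Metric.ball x r} ∈ 𝓝 (D.q x) :=
      (hD.isOpen_setOf_subset Metric.isOpen_ball).mem_nhds (by simp [hqx, hr])
    obtain ⟨r, hr, hrW⟩ := Metric.mem_nhds_iff.1 (continuous_q.continuousAt hW)
    have hW' {B : D.Space} (hB : B.1 ⊆ Metric.ball x r) : B ∈ W := by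
      obtain ⟨b, rfl⟩ := exists_q_eq B
      exact hrW (hB (D.mem_q b))
    obtain ⟨s, hs, hsr⟩ := Metric.mem_nhds_iff.1
      (continuous_q.continuousAt (hball (half_pos hr)))
    refine ⟨{B | B.1 ⊆ Metric.ball x (min (s / 2) r)}, hball (by positivity),
      fun B hB => hW' (hB.trans (Metric.ball_subset_ball (min_le_right _ _))), ?_⟩
    rintro _ ⟨P, -, rfl⟩ ⟨B, ⟨-, hBP⟩, hBs⟩ C ⟨-, hC⟩
    obtain ⟨z, rfl⟩ := exists_q_eq B
    have hzx : dist z x < s / 2 :=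
      (Metric.mem_ball.1 (hBs (D.mem_q z))).trans_le (min_le_left _ _)
    obtain ⟨p, hp, hzp⟩ := hO (hBP (D.mem_q z)) hx
    have hps : p ∈ Metric.ball x s := by
      have := dist_triangle_left p x z
      rw [Metric.mem_ball]
      linarith
    have hP : P.1 ⊆ Metric.ball x (r / 2) := eq_q hp ▸ hsr hps
    refine hW' fun y hy => ?_
    obtain ⟨p', hp', hyp'⟩ := hO (hC hy) hx
    have h₁ := Metric.mem_ball.1 (hP hp')
    have h₂ := dist_triangle y p' x
    have h₃ : 0 ≤ dist y p' := dist_nonneg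
    rw [Metric.mem_ball]
    linarith

end Decomposition

open Classical in
/-- Lemma: a homeomorphism of the `q_D`-preimage `V` of a neighborhood `U` of the
non-degeneracy part onto `U`, sufficiently close to `q_D`, extends by `q_D` (which is
`x ↦ {x}` off `V`) to a homeomorphism of `X` onto the decomposition space. -/
theorem approx_extension_homeomorph (X : Type*) [TopologicalSpace X]
    [TopologicalSpace.MetrizableSpace X] (D : Decomposition X) (hD : D.Vanishing)
    (U : Set D.Space) (hU : IsOpen U) (hnd : D.nondeg ⊆ U) :
    ∃ 𝒰 : Set (Set D.Space), (∀ u ∈ 𝒰, IsOpen u ∧ u ⊆ U) ∧ U ⊆ ⋃₀ 𝒰 ∧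
      ∀ h : ↥(D.q ⁻¹' U) ≃ₜ ↥U,
        (∀ x : ↥(D.q ⁻¹' U), (h x : D.Space) ≠ D.q (x : X) →
          ∃ u ∈ 𝒰, (h x : D.Space) ∈ u ∧ D.q (x : X) ∈ u) →
        IsHomeomorph (fun x : X =>
          if hx : x ∈ D.q ⁻¹' U then (h ⟨x, hx⟩ : D.Space) else D.q x) := by
  let := TopologicalSpace.metrizableSpaceMetric X
  have hUSC := hD.isUSC
  obtain ⟨𝒰, h𝒰, hcov, hshrink⟩ := hUSC.exists_cover_shrinking hU hnd
  refine ⟨𝒰, h𝒰, hcov, fun h hh => ?_⟩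
  set f : X → D.Space := fun x =>
    if hx : x ∈ D.q ⁻¹' U then (h ⟨x, hx⟩ : D.Space) else D.q x
  have hV : IsOpen (D.q ⁻¹' U) := hU.preimage Decomposition.continuous_q
  have hfV (x : D.q ⁻¹' U) : f x = h x := dif_pos x.2
  have hfA {x : X} (hx : D.q x ∉ U) : f x = D.q x := dif_neg hx
  have hfU {x : X} (hx : D.q x ∈ U) : f x ∈ U := by
    rw [hfV ⟨x, hx⟩]
    exact (h ⟨x, hx⟩).2
  have hnear (x : X) : f x = D.q x ∨ ∃ u ∈ 𝒰, f x ∈ u ∧ D.q x ∈ u := by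
    by_cases hx : D.q x ∈ U
    · rw [hfV ⟨x, hx⟩]
      exact or_iff_not_imp_left.2 (hh ⟨x, hx⟩)
    · exact Or.inl (hfA hx)
  have hinj : Function.Injective f := by
    intro x y hxy
    by_cases hx : D.q x ∈ U <;> by_cases hy : D.q y ∈ U
    · rw [hfV ⟨x, hx⟩, hfV ⟨y, hy⟩] at hxy
      exact congrArg Subtype.val (h.injective (Subtype.ext hxy))
    · exact absurd (hfA hy ▸ hxy ▸ hfU hx) hy
    · exact absurd (hfA hx ▸ hxy ▸ hfU hy) hx
    · rw [hfA hx, hfA hy] at hxy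
      have hxy' : x ∈ (D.q y).1 := hxy ▸ D.mem_q x
      rwa [Decomposition.coe_q_eq_singleton fun h => hy (hnd h)] at hxy'
  have hsurj : Function.Surjective f := by
    intro B
    by_cases hB : B ∈ U
    · exact ⟨h.symm ⟨B, hB⟩, by rw [hfV, h.apply_symm_apply]⟩
    · obtain ⟨x, rfl⟩ := Decomposition.exists_q_eq B
      exact ⟨x, hfA hB⟩
  have hcomp : f ∘ ((↑) : D.q ⁻¹' U → X) = (↑) ∘ h := funext hfV
  refine ⟨continuous_iff_continuousAt.2 fun x => ?_, IsOpenMap.of_nhds_le fun x => ?_,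
    hinj, hsurj⟩
  · by_cases hx : D.q x ∈ U
    · refine (hV.isOpenEmbedding_subtypeVal.continuousAt_iff (x := ⟨x, hx⟩)).1 ?_
      rw [hcomp]
      exact (continuous_subtype_val.comp h.continuous).continuousAt
    · intro W hW
      rw [hfA hx] at hW
      obtain ⟨W', hW', hW'W, hst⟩ := hshrink x hx W hW
      have hqW' : D.q ⁻¹' W' ∈ 𝓝 x := Decomposition.continuous_q.continuousAt hW'
      refine Filter.mem_map.2 ?_
      filter_upwards [hqW'] with z hz
      rcases hnear z with hz' | ⟨u, hu, hzu, hqu⟩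
      · exact hW'W (hz'.symm ▸ hz)
      · exact hst u hu ⟨_, hqu, hz⟩ hzu
  · by_cases hx : D.q x ∈ U
    · have h₁ := (hU.isOpenMap_subtype_val.comp h.isOpenMap).nhds_le ⟨x, hx⟩
      rw [← hcomp, ← Filter.map_map] at h₁
      exact h₁.trans (Filter.map_mono continuous_subtype_val.continuousAt)
    · intro S hS
      have hO : {B : D.Space | B.1 ⊆ interior (f ⁻¹' S)} ∈ 𝓝 (D.q x) := by
        refine (hUSC.isOpen_setOf_subset isOpen_interior).mem_nhds ?_
        rw [mem_ofPred_eq, Decomposition.coe_q_eq_singleton fun h => hx (hnd h),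
          singleton_subset_iff]
        exact mem_interior_iff_mem_nhds.2 hS
      obtain ⟨W', hW', hW'W, hst⟩ := hshrink x hx _ hO
      rw [hfA hx]
      filter_upwards [hW'] with B hB
      obtain ⟨z, rfl⟩ := hsurj B
      suffices hz : z ∈ interior (f ⁻¹' S) from interior_subset (s := f ⁻¹' S) hz
      rcases hnear z with hz | ⟨u, hu, hzu, hqu⟩
      · exact hW'W (hz ▸ hB) (D.mem_q z)
      · exact hst u hu ⟨_, hzu, hB⟩ hqu (D.mem_q z)

end
end

section
/- Let X be a strongly locally homogeneous completely metrizable space. Then for any open subspace U ⊆ X, any open cover U of U, and any subsets A, B ⊆ U that are σ-discrete in X and dense in U, there is a homeomorphism h : X → X such that h(A) = B and (h, id_X) ≺ U. -/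
open Set Topology unitInterval

noncomputable section

/-! ### Closed discrete sets -/

open Filter in
theorem compl_mem_codiscrete_iff_eventually_eq {X : Type*} [TopologicalSpace X] {D : Set X} :
    Dᶜ ∈ codiscrete X ↔ ∀ x, ∀ᶠ y in 𝓝 x, y ∈ D → y = x := by
  simp only [mem_codiscrete, compl_compl, disjoint_principal_right, mem_nhdsWithin_iff_eventually]
  refine forall_congr' fun x => eventually_congr (Eventually.of_forall fun y => ?_)
  simp only [mem_compl_iff, mem_singleton_iff]
  tauto

theorem image_compl_mem_codiscrete {X : Type*} [TopologicalSpace X] {D : Set X}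
    (hD : Dᶜ ∈ Filter.codiscrete X) (h : X ≃ₜ X) : (⇑h '' D)ᶜ ∈ Filter.codiscrete X := by
  rw [compl_mem_codiscrete_iff_eventually_eq] at hD ⊢
  intro x
  filter_upwards [h.symm.continuous.continuousAt.eventually (hD (h.symm x))] with y hy
  rintro ⟨z, hz, rfl⟩
  simpa [Homeomorph.eq_symm_apply] using hy (by simpa using hz)

/-- The points of a closed discrete subset of a metric space have neighborhoods forming a
discrete family. -/
theorem exists_discrete_family_nhds {X : Type*} [MetricSpace X] {D : Set X}
    (hD : Dᶜ ∈ Filter.codiscrete X) :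
    ∃ O : X → Set X, (∀ p, O p ∈ 𝓝 p) ∧ ∀ x, ∃ W ∈ 𝓝 x, ∀ p ∈ D, ∀ q ∈ D,
      (O p ∩ W).Nonempty → (O q ∩ W).Nonempty → p = q := by
  rw [compl_mem_codiscrete_iff_eventually_eq] at hD
  simp only [Metric.eventually_nhds_iff] at hD
  choose s hs0 hs using hD
  refine ⟨fun p => Metric.ball p (s p / 4),
    fun p => Metric.ball_mem_nhds _ (by linarith [hs0 p]), fun x => ?_⟩
  refine ⟨Metric.ball x (s x / 2), Metric.ball_mem_nhds _ (by linarith [hs0 x]), ?_⟩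
  rintro p hp q hq ⟨y, hyp, hyx⟩ ⟨z, hzq, hzx⟩
  by_contra hpq
  have hsp : s p ≤ dist p q := by
    by_contra! hlt
    exact hpq (hs p (by rwa [dist_comm]) hq).symm
  have hsq : s q ≤ dist p q := by
    by_contra! hlt
    exact hpq (hs q hlt hp)
  have hp' : p = x ∨ s x ≤ dist p x := by
    by_contra! hlt
    exact hlt.1 (hs x hlt.2 hp)
  have hq' : q = x ∨ s x ≤ dist q x := by
    by_contra! hlt
    exact hlt.1 (hs x hlt.2 hq)
  rw [Metric.mem_ball] at hyp hyx hzq hzx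
  have h1 : dist p x ≤ dist y p + dist y x := dist_triangle_left p x y
  have h2 : dist q x ≤ dist z q + dist z x := dist_triangle_left q x z
  have h3 : dist p q ≤ dist p x + dist q x := dist_triangle_right p q x
  have h0 : 0 < dist p q := dist_pos.2 hpq
  have hcomm := dist_comm p q
  rcases hp' with rfl | hp' <;> rcases hq' with rfl | hq'
  · exact hpq rfl
  · linarith
  · linarith
  · linarith

/-! ### Gluing homeomorphisms with supports in a discrete family -/

theorem apply_mem_of_forall_notMem_eq {X : Type*} {h : X → X} (hinj : Function.Injective h)
    {O : Set X} (hO : ∀ z ∉ O, h z = z) {x : X} (hx : x ∈ O) : h x ∈ O := by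
  by_contra hn
  rw [hinj (hO _ hn)] at hn
  exact hn hx

/-- The map equal to `k i` on `O i` and to the identity off `⋃ i, O i`. -/
def glueSupported {X ι : Type*} (O : ι → Set X) (k : ι → X → X) (x : X) : X :=
  open Classical in if hx : ∃ i, x ∈ O i then k hx.choose x else x

theorem glueSupported_of_mem {X ι : Type*} {O : ι → Set X} (k : ι → X → X)
    (hO : ∀ i j, (O i ∩ O j).Nonempty → i = j) {x : X} {i : ι} (hx : x ∈ O i) :
    glueSupported O k x = k i x := by
  have h : ∃ i, x ∈ O i := ⟨i, hx⟩
  rw [glueSupported, dif_pos h, hO h.choose i ⟨x, h.choose_spec, hx⟩]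

theorem glueSupported_of_notMem {X ι : Type*} {O : ι → Set X} (k : ι → X → X) {x : X}
    (hx : ∀ i, x ∉ O i) : glueSupported O k x = x :=
  dif_neg (by simpa using hx)

theorem continuous_glueSupported {X ι : Type*} [TopologicalSpace X] {O : ι → Set X}
    {k : ι → X → X}
    (hO : ∀ x, ∃ W ∈ 𝓝 x, ∀ i j, (O i ∩ W).Nonempty → (O j ∩ W).Nonempty → i = j)
    (hO' : ∀ i j, (O i ∩ O j).Nonempty → i = j)
    (hk : ∀ i, Continuous (k i)) (hid : ∀ i, ∀ x ∉ O i, k i x = x) :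
    Continuous (glueSupported O k) := by
  rw [continuous_iff_continuousAt]
  intro x
  obtain ⟨W, hW, huniq⟩ := hO x
  by_cases hex : ∃ i, (O i ∩ W).Nonempty
  · obtain ⟨i, hi⟩ := hex
    refine (hk i).continuousAt.congr ?_
    filter_upwards [hW] with y hy
    by_cases hyi : ∃ j, y ∈ O j
    · obtain ⟨j, hj⟩ := hyi
      obtain rfl := huniq i j hi ⟨y, hj, hy⟩
      rw [glueSupported_of_mem k hO' hj]
    · push Not at hyi
      rw [glueSupported_of_notMem k hyi, hid i y (hyi i)]
  · refine continuousAt_id.congr ?_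
    filter_upwards [hW] with y hy
    exact (glueSupported_of_notMem k fun i hi => hex ⟨i, y, hi, hy⟩).symm

theorem glueSupported_comp_of_leftInverse {X ι : Type*} {O : ι → Set X} {k l : ι → X → X}
    (hO : ∀ i j, (O i ∩ O j).Nonempty → i = j) (hkO : ∀ i, MapsTo (k i) (O i) (O i))
    (hlk : ∀ i, Function.LeftInverse (l i) (k i)) :
    Function.LeftInverse (glueSupported O l) (glueSupported O k) := by
  intro x
  by_cases hx : ∃ i, x ∈ O i
  · obtain ⟨i, hi⟩ := hx
    rw [glueSupported_of_mem k hO hi, glueSupported_of_mem l hO (hkO i hi), hlk i x]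
  · push Not at hx
    rw [glueSupported_of_notMem k hx, glueSupported_of_notMem l hx]

theorem exists_homeomorph_glue {X ι : Type*} [TopologicalSpace X] {O : ι → Set X}
    (hO : ∀ x, ∃ W ∈ 𝓝 x, ∀ i j, (O i ∩ W).Nonempty → (O j ∩ W).Nonempty → i = j)
    (h : ι → X ≃ₜ X) (hid : ∀ i, ∀ x ∉ O i, h i x = x) :
    ∃ g : X ≃ₜ X, (∀ i, ∀ x ∈ O i, g x = h i x) ∧ ∀ x, (∀ i, x ∉ O i) → g x = x := by
  have hO' : ∀ i j, (O i ∩ O j).Nonempty → i = j := by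
    rintro i j ⟨x, hi, hj⟩
    obtain ⟨W, hW, huniq⟩ := hO x
    exact huniq i j ⟨x, hi, mem_of_mem_nhds hW⟩ ⟨x, hj, mem_of_mem_nhds hW⟩
  have hid' : ∀ i, ∀ x ∉ O i, (h i).symm x = x := fun i x hx => by
    rw [Homeomorph.symm_apply_eq, hid i x hx]
  refine ⟨⟨⟨glueSupported O fun i => h i, glueSupported O fun i => (h i).symm, ?_, ?_⟩, ?_, ?_⟩,
    fun i x hx => glueSupported_of_mem (fun i => h i) hO' hx,
    fun x hx => glueSupported_of_notMem (fun i => h i) hx⟩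
  · exact glueSupported_comp_of_leftInverse hO'
      (fun i x hx => apply_mem_of_forall_notMem_eq (h i).injective (hid i) hx)
      fun i => (h i).symm_apply_apply
  · exact glueSupported_comp_of_leftInverse hO'
      (fun i x hx => apply_mem_of_forall_notMem_eq (h i).symm.injective (hid' i) hx)
      fun i => (h i).apply_symm_apply
  · exact continuous_glueSupported hO hO' (fun i => (h i).continuous) hid
  · exact continuous_glueSupported hO hO' (fun i => (h i).symm.continuous) hid'

/-- A closed discrete set `D` can be moved into any set `T` having `D` in its closure by a
homeomorphism supported in prescribed neighborhoods of the points of `D`. -/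
theorem StronglyLocallyHomogeneous.exists_homeomorph_mapsTo {X : Type*} [MetricSpace X]
    (hX : StronglyLocallyHomogeneous X) {D T : Set X} (hD : Dᶜ ∈ Filter.codiscrete X)
    (hDT : D ⊆ closure T) {N : X → Set X} (hN : ∀ p ∈ D, N p ∈ 𝓝 p) :
    ∃ g : X ≃ₜ X, MapsTo g D T ∧ ∀ x, g x ≠ x → ∃ p ∈ D, x ∈ N p ∧ g x ∈ N p := by
  obtain ⟨O, hOn, hO⟩ := exists_discrete_family_nhds hD
  have hmove : ∀ p : D, ∃ h : X ≃ₜ X, h p ∈ T ∧ ∀ z ∉ O p ∩ N p, h z = z := by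
    intro p
    obtain ⟨V, hV, -, hmv⟩ := hX p (O p ∩ N p) (Filter.inter_mem (hOn p) (hN p p.2))
    obtain ⟨t, htV, htT⟩ := mem_closure_iff_nhds.1 (hDT p.2) V hV
    obtain ⟨h, rfl, hid⟩ := hmv t htV
    exact ⟨h, htT, hid⟩
  choose h hT hid using hmove
  obtain ⟨g, hg, hgid⟩ := exists_homeomorph_glue (O := fun p : D => O p ∩ N p) (fun x => by
    obtain ⟨W, hW, huniq⟩ := hO x
    exact ⟨W, hW, fun i j hi hj => Subtype.ext <| huniq i i.2 j j.2
      (hi.mono <| inter_subset_inter_left _ inter_subset_left)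
      (hj.mono <| inter_subset_inter_left _ inter_subset_left)⟩) h hid
  refine ⟨g, fun p hp => ?_, fun x hx => ?_⟩
  · rw [hg ⟨p, hp⟩ p ⟨mem_of_mem_nhds (hOn p), mem_of_mem_nhds (hN p hp)⟩]
    exact hT ⟨p, hp⟩
  · by_cases hex : ∃ i : D, x ∈ O i ∩ N i
    · obtain ⟨i, hi⟩ := hex
      refine ⟨i, i.2, hi.2, ?_⟩
      rw [hg i x hi]
      exact (apply_mem_of_forall_notMem_eq (h i).injective (hid i) hi).2
    · exact absurd (hgid x (by simpa only [not_exists] using hex)) hx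

/-! ### Controlled perturbations of homeomorphisms -/

/-- `h'` is `δ`-close to `h`, relatively to the gauge `ρ`, and so are the inverses. -/
def GaugeClose {X : Type*} [MetricSpace X] (ρ : X → ℝ) (δ : ℝ) (h h' : X ≃ₜ X) : Prop :=
  (∀ x, dist (h x) (h' x) ≤ δ * ρ x) ∧ ∀ y, dist (h.symm y) (h'.symm y) ≤ δ

theorem GaugeClose.trans {X : Type*} [MetricSpace X] {ρ : X → ℝ} {δ δ' : ℝ}
    {h h' h'' : X ≃ₜ X} (H : GaugeClose ρ δ h h') (H' : GaugeClose ρ δ' h' h'') :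
    GaugeClose ρ (δ + δ') h h'' :=
  ⟨fun x => by linarith [dist_triangle (h x) (h' x) (h'' x), H.1 x, H'.1 x],
    fun y => (dist_triangle _ _ _).trans (add_le_add (H.2 y) (H'.2 y))⟩

theorem GaugeClose.apply_eq {X : Type*} [MetricSpace X] {ρ : X → ℝ} {δ : ℝ} {h h' : X ≃ₜ X}
    (H : GaugeClose ρ δ h h') {x : X} (hx : ρ x = 0) : h' x = h x := by
  have := H.1 x
  rw [hx, mul_zero] at this
  exact (dist_le_zero.1 this).symm

theorem gaugeClose_trans_of_moves {X : Type*} [MetricSpace X] {ρ : X → ℝ} {δ : ℝ}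
    (hδ : 0 ≤ δ) (hρ : ∀ x, 0 ≤ ρ x) {h g : X ≃ₜ X}
    (hg : ∀ y, g y ≠ y → dist y (g y) ≤ δ * ρ (h.symm y) ∧
      dist (h.symm y) (h.symm (g y)) ≤ δ) :
    GaugeClose ρ δ h (h.trans g) := by
  refine ⟨fun x => ?_, fun y => ?_⟩
  · by_cases hx : g (h x) = h x
    · simpa [hx] using mul_nonneg hδ (hρ x)
    · simpa using (hg _ hx).1
  · by_cases hy : g (g.symm y) = g.symm y
    · have : g.symm y = y := by rw [← hy, g.apply_symm_apply]
      simpa [this] using hδ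
    · simpa [dist_comm] using (hg _ hy).2

/-- A gauge controls the open set `U` when it is nonnegative, vanishes off `U`, and is locally
bounded away from zero on `U`. -/
structure IsGauge {X : Type*} [TopologicalSpace X] (U : Set X) (ρ : X → ℝ) : Prop where
  nonneg : ∀ x, 0 ≤ ρ x
  eq_zero : ∀ x ∉ U, ρ x = 0
  eventually_le : ∀ x ∈ U, ∃ c > 0, ∀ᶠ y in 𝓝 x, c ≤ ρ y

theorem exists_isGauge_ball_subset {X : Type*} [MetricSpace X] {U : Set X} {𝒰 : Set (Set X)}
    (h𝒰 : ∀ u ∈ 𝒰, IsOpen u ∧ u ⊆ U) (hcov : U ⊆ ⋃₀ 𝒰) :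
    ∃ ρ : X → ℝ, IsGauge U ρ ∧ (∀ x, ρ x ≤ 1) ∧
      ∀ x, ∀ r < ρ x, 0 ≤ r → ∃ u ∈ 𝒰, Metric.closedBall x r ⊆ u := by
  let S : X → Set ℝ := fun x => {r | r = 0 ∨ r ≤ 1 ∧ ∃ u ∈ 𝒰, Metric.ball x r ⊆ u}
  have hS1 : ∀ x, ∀ r ∈ S x, r ≤ 1 := by
    rintro x r (rfl | h)
    · exact zero_le_one
    · exact h.1
  have hbdd : ∀ x, BddAbove (S x) := fun x => ⟨1, hS1 x⟩
  have h0 : ∀ x, (0 : ℝ) ∈ S x := fun x => Or.inl rfl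
  refine ⟨fun x => sSup (S x), ⟨fun x => le_csSup (hbdd x) (h0 x), fun x hx => ?_,
    fun x hx => ?_⟩, fun x => csSup_le ⟨0, h0 x⟩ (hS1 x), fun x r hr hr0 => ?_⟩
  · refine le_antisymm (csSup_le ⟨0, h0 x⟩ ?_) (le_csSup (hbdd x) (h0 x))
    rintro r (rfl | ⟨-, u, hu, hru⟩)
    · exact le_rfl
    · by_contra! hr
      exact hx ((h𝒰 u hu).2 (hru (Metric.mem_ball_self hr)))
  · obtain ⟨u, hu, hxu⟩ := hcov hx
    obtain ⟨ε, hε, hεu⟩ := Metric.isOpen_iff.1 (h𝒰 u hu).1 x hxu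
    have hc : 0 < min 1 (ε / 2) := lt_min one_pos (half_pos hε)
    refine ⟨min 1 (ε / 2), hc, ?_⟩
    filter_upwards [Metric.ball_mem_nhds x hc] with y hy
    refine le_csSup (hbdd y) (Or.inr ⟨min_le_left _ _, u, hu, fun z hz => hεu ?_⟩)
    rw [Metric.mem_ball] at hy hz ⊢
    have := min_le_right 1 (ε / 2)
    linarith [dist_triangle z y x]
  · obtain ⟨s, hs, hrs⟩ := exists_lt_of_lt_csSup ⟨0, h0 x⟩ hr
    obtain rfl | ⟨-, u, hu, hsu⟩ := hs
    · exact absurd hrs hr0.not_gt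
    · exact ⟨u, hu, (Metric.closedBall_subset_ball hrs).trans hsu⟩

theorem image_eq_of_forall_notMem_eq {X : Type*} {h : X ≃ X} {U : Set X}
    (hU : ∀ x ∉ U, h x = x) : ⇑h '' U = U := by
  ext y
  constructor
  · rintro ⟨x, hx, rfl⟩
    exact apply_mem_of_forall_notMem_eq h.injective hU hx
  · intro hy
    refine ⟨h.symm y, ?_, h.apply_symm_apply y⟩
    exact apply_mem_of_forall_notMem_eq h.symm.injective
      (fun z hz => by rw [Equiv.symm_apply_eq, hU z hz]) hy

/-- After a homeomorphism `h` supported in `U`, a closed discrete set `E ⊆ U` can be moved into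
a set `T` dense in `U`, without moving the closed set `C` and staying close to `h`. -/
theorem StronglyLocallyHomogeneous.exists_gaugeClose {X : Type*} [MetricSpace X]
    (hX : StronglyLocallyHomogeneous X) {U : Set X} {ρ : X → ℝ} (hρ : IsGauge U ρ)
    {h : X ≃ₜ X} (hU : ∀ x ∉ U, h x = x) {C E T : Set X} (hC : IsClosed C)
    (hE : Eᶜ ∈ Filter.codiscrete X) (hEU : E ⊆ U) (hEC : Disjoint E C) (hT : U ⊆ closure T)
    {δ : ℝ} (hδ : 0 < δ) :
    ∃ g : X ≃ₜ X, MapsTo g E T ∧ (∀ y ∈ C, g y = y) ∧ GaugeClose ρ δ h (h.trans g) ∧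
      GaugeClose ρ δ h (h.trans g.symm) := by
  have hnhds : ∀ p, ∃ N : Set X, p ∈ E → N ∈ 𝓝 p ∧ N ⊆ Cᶜ ∧ ∀ y ∈ N, ∀ z ∈ N,
      dist y z ≤ δ * ρ (h.symm y) ∧ dist (h.symm y) (h.symm z) ≤ δ := by
    intro p
    by_cases hp : p ∈ E
    swap
    · exact ⟨∅, fun h => absurd h hp⟩
    have hpU : h.symm p ∈ U := by
      have := hEU hp
      rw [← image_eq_of_forall_notMem_eq (h := h.toEquiv) hU] at this
      obtain ⟨x, hx, rfl⟩ := this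
      simpa using hx
    obtain ⟨c, hc, hcρ⟩ := hρ.eventually_le _ hpU
    refine ⟨{y | y ∈ Cᶜ ∧ c ≤ ρ (h.symm y) ∧ y ∈ Metric.ball p (δ * c / 2) ∧
      h.symm y ∈ Metric.ball (h.symm p) (δ / 2)}, fun _ => ⟨?_, fun y hy => hy.1, ?_⟩⟩
    · have hcont : ContinuousAt h.symm p := h.symm.continuous.continuousAt
      exact Filter.inter_mem (hC.isOpen_compl.mem_nhds (disjoint_left.1 hEC hp)) <|
        Filter.inter_mem (hcont.eventually hcρ) <|
        Filter.inter_mem (Metric.ball_mem_nhds _ (by positivity)) <|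
        hcont.preimage_mem_nhds (Metric.ball_mem_nhds _ (by positivity))
    · rintro y ⟨-, hy, hy1, hy2⟩ z ⟨-, -, hz1, hz2⟩
      rw [Metric.mem_ball] at hy1 hy2 hz1 hz2
      have := mul_le_mul_of_nonneg_left hy hδ.le
      constructor
      · linarith [dist_triangle_right y z p]
      · linarith [dist_triangle_right (h.symm y) (h.symm z) (h.symm p)]
  choose N hN using hnhds
  obtain ⟨g, hgT, hg⟩ := hX.exists_homeomorph_mapsTo hE (hEU.trans hT) fun p hp => (hN p hp).1
  refine ⟨g, hgT, fun y hy => ?_, gaugeClose_trans_of_moves hδ.le hρ.nonneg fun y hy => ?_,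
    gaugeClose_trans_of_moves hδ.le hρ.nonneg fun y hy => ?_⟩
  · by_contra hne
    obtain ⟨p, hp, hyp, -⟩ := hg y hne
    exact (hN p hp).2.1 hyp hy
  · obtain ⟨p, hp, hyp, hgyp⟩ := hg y hy
    exact (hN p hp).2.2 y hyp (g y) hgyp
  · obtain ⟨p, hp, hyp, hgyp⟩ := hg (g.symm y) (by simpa [eq_comm] using hy)
    rw [g.apply_symm_apply] at hgyp
    exact (hN p hp).2.2 y hgyp (g.symm y) hyp

/-! ### The back-and-forth construction -/

/-- A partial matching of `A` with `B`: the homeomorphism `s.1`, supported in `U`, sends the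
closed discrete set `s.2 ⊆ A` into `B`. -/
structure IsPartialMatching {X : Type*} [TopologicalSpace X] (U A B : Set X)
    (s : (X ≃ₜ X) × Set X) : Prop where
  apply_eq : ∀ x ∉ U, s.1 x = x
  compl_mem : s.2ᶜ ∈ Filter.codiscrete X
  subset : s.2 ⊆ A
  mapsTo : MapsTo s.1 s.2 B

theorem IsPartialMatching.isClosed_image {X : Type*} [TopologicalSpace X] {U A B : Set X}
    {s : (X ≃ₜ X) × Set X} (hs : IsPartialMatching U A B s) : IsClosed (⇑s.1 '' s.2) :=
  s.1.isClosedMap _ (compl_mem_codiscrete_iff.1 hs.compl_mem).1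

theorem IsPartialMatching.exists_extend_source {X : Type*} [MetricSpace X]
    (hX : StronglyLocallyHomogeneous X) {U A B : Set X} {ρ : X → ℝ} (hρ : IsGauge U ρ)
    (hAU : A ⊆ U) (hBd : U ⊆ closure B) {s : (X ≃ₜ X) × Set X} (hs : IsPartialMatching U A B s)
    {A₀ : Set X} (hA₀ : A₀ᶜ ∈ Filter.codiscrete X) (hA₀A : A₀ ⊆ A) {δ : ℝ} (hδ : 0 < δ) :
    ∃ s', IsPartialMatching U A B s' ∧ GaugeClose ρ δ s.1 s'.1 ∧ s.2 ⊆ s'.2 ∧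
      EqOn s'.1 s.1 s.2 ∧ A₀ ⊆ s'.2 := by
  obtain ⟨g, hgB, hgid, hclose, -⟩ := hX.exists_gaugeClose hρ hs.apply_eq hs.isClosed_image
    (E := ⇑s.1 '' (A₀ \ s.2)) (T := B)
    (image_compl_mem_codiscrete (Filter.mem_of_superset hA₀ <|
      compl_subset_compl.2 sdiff_subset) _)
    (by
      rintro _ ⟨x, hx, rfl⟩
      exact apply_mem_of_forall_notMem_eq s.1.injective hs.apply_eq (hAU (hA₀A hx.1)))
    ((disjoint_image_iff s.1.injective).2 disjoint_sdiff_left) hBd hδ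
  have heq : EqOn (s.1.trans g) s.1 s.2 := fun x hx => hgid _ (mem_image_of_mem _ hx)
  refine ⟨(s.1.trans g, s.2 ∪ A₀), ⟨fun x hx => ?_, ?_, union_subset hs.subset hA₀A, ?_⟩, hclose,
    subset_union_left, heq, subset_union_right⟩
  · rw [hclose.apply_eq (hρ.eq_zero x hx), hs.apply_eq x hx]
  · rw [compl_union]
    exact Filter.inter_mem hs.compl_mem hA₀
  · intro x hx
    by_cases hxs : x ∈ s.2
    · rw [heq hxs]
      exact hs.mapsTo hxs
    · exact hgB (mem_image_of_mem _ ⟨hx.resolve_left hxs, hxs⟩)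

theorem IsPartialMatching.exists_extend_target {X : Type*} [MetricSpace X]
    (hX : StronglyLocallyHomogeneous X) {U A B : Set X} {ρ : X → ℝ} (hρ : IsGauge U ρ)
    (hBU : B ⊆ U) (hAd : U ⊆ closure A) {s : (X ≃ₜ X) × Set X} (hs : IsPartialMatching U A B s)
    {B₀ : Set X} (hB₀ : B₀ᶜ ∈ Filter.codiscrete X) (hB₀B : B₀ ⊆ B) {δ : ℝ} (hδ : 0 < δ) :
    ∃ s', IsPartialMatching U A B s' ∧ GaugeClose ρ δ s.1 s'.1 ∧ s.2 ⊆ s'.2 ∧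
      EqOn s'.1 s.1 s.2 ∧ B₀ ⊆ ⇑s'.1 '' s'.2 := by
  have hE : (B₀ \ ⇑s.1 '' s.2)ᶜ ∈ Filter.codiscrete X :=
    Filter.mem_of_superset hB₀ (compl_subset_compl.2 sdiff_subset)
  obtain ⟨g, hgA, hgid, -, hclose⟩ := hX.exists_gaugeClose hρ hs.apply_eq hs.isClosed_image
    (T := ⇑s.1 '' A) hE (sdiff_subset.trans (hB₀B.trans hBU)) disjoint_sdiff_left
    (by
      rw [← s.1.image_closure, ← image_eq_of_forall_notMem_eq (h := s.1.toEquiv) hs.apply_eq]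
      exact image_mono hAd) hδ
  have heq : EqOn (s.1.trans g.symm) s.1 s.2 := fun x hx => by
    rw [Homeomorph.trans_apply, Homeomorph.symm_apply_eq, hgid _ (mem_image_of_mem _ hx)]
  have hinv : ∀ b, (s.1.trans g.symm) (s.1.symm (g b)) = b := fun b => by simp
  refine ⟨(s.1.trans g.symm, s.2 ∪ ⇑s.1.symm '' (⇑g '' (B₀ \ ⇑s.1 '' s.2))),
    ⟨fun x hx => ?_, ?_, union_subset hs.subset ?_, ?_⟩, hclose, subset_union_left, heq, ?_⟩
  · rw [hclose.apply_eq (hρ.eq_zero x hx), hs.apply_eq x hx]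
  · rw [compl_union]
    exact Filter.inter_mem hs.compl_mem
      (image_compl_mem_codiscrete (image_compl_mem_codiscrete hE g) s.1.symm)
  · rintro _ ⟨_, ⟨b, hb, rfl⟩, rfl⟩
    obtain ⟨a, ha, hab⟩ := hgA hb
    rw [← hab]
    simpa using ha
  · rintro x (hx | ⟨_, ⟨b, hb, rfl⟩, rfl⟩)
    · rw [heq hx]
      exact hs.mapsTo hx
    · rw [hinv]
      exact hB₀B hb.1
  · intro b hb
    by_cases hbs : b ∈ ⇑s.1 '' s.2
    · obtain ⟨a, ha, rfl⟩ := hbs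
      exact ⟨a, Or.inl ha, heq ha⟩
    · exact ⟨s.1.symm (g b), Or.inr ⟨_, ⟨b, ⟨hb, hbs⟩, rfl⟩, rfl⟩, hinv b⟩

/-! ### Limits of homeomorphisms -/

theorem exists_tendstoUniformly_of_dist_le_geometric_two {X Y : Type*} [MetricSpace Y]
    [CompleteSpace Y] {f : ℕ → X → Y} {C : ℝ}
    (hf : ∀ n x, dist (f n x) (f (n + 1) x) ≤ C / 2 / 2 ^ n) :
    ∃ F : X → Y, TendstoUniformly f F Filter.atTop := by
  choose F hF using fun x => cauchySeq_tendsto_of_complete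
    (cauchySeq_of_le_geometric_two fun n => hf n x)
  refine ⟨F, Metric.tendstoUniformly_iff.2 fun ε hε => ?_⟩
  have hlim : Filter.Tendsto (fun n : ℕ => C / 2 ^ n) Filter.atTop (𝓝 0) :=
    tendsto_const_nhds.div_atTop (tendsto_pow_atTop_atTop_of_one_lt one_lt_two)
  filter_upwards [hlim.eventually (gt_mem_nhds hε)] with n hn x
  rw [dist_comm]
  exact (dist_le_of_le_geometric_two_of_tendsto (fun n => hf n x) (hF x) n).trans_lt hn

/-- A sequence of homeomorphisms of a complete space converging fast, together with the
inverses, converges to a homeomorphism. -/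
theorem exists_homeomorph_tendsto {X : Type*} [MetricSpace X] [CompleteSpace X]
    {h : ℕ → X ≃ₜ X} {C : ℝ}
    (hh : ∀ n x, dist (h n x) (h (n + 1) x) ≤ C / 2 / 2 ^ n)
    (hh' : ∀ n x, dist ((h n).symm x) ((h (n + 1)).symm x) ≤ C / 2 / 2 ^ n) :
    ∃ f : X ≃ₜ X, ∀ x, Filter.Tendsto (fun n => h n x) Filter.atTop (𝓝 (f x)) := by
  obtain ⟨f, hf⟩ := exists_tendstoUniformly_of_dist_le_geometric_two (f := fun n => h n) hh
  obtain ⟨k, hk⟩ := exists_tendstoUniformly_of_dist_le_geometric_two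
    (f := fun n => (h n).symm) hh'
  have hfc : Continuous f := hf.continuous (Filter.Frequently.of_forall fun n => (h n).continuous)
  have hkc : Continuous k :=
    hk.continuous (Filter.Frequently.of_forall fun n => (h n).symm.continuous)
  refine ⟨⟨⟨f, k, fun x => ?_, fun y => ?_⟩, hfc, hkc⟩, fun x => hf.tendsto_at x⟩
  · refine tendsto_nhds_unique (hk.tendsto_comp hkc.continuousAt (hf.tendsto_at x)) ?_
    simp
  · refine tendsto_nhds_unique (hf.tendsto_comp hfc.continuousAt (hk.tendsto_at y)) ?_
    simp

/-- Theorem: in a strongly locally homogeneous completely metrizable space, any two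
σ-discrete subsets of an open set `U`, dense in `U`, are ambiently homeomorphic by a
homeomorphism `𝒰`-close to the identity. -/
theorem sigmaDiscrete_dense_ambient (X : Type*) [TopologicalSpace X]
    (hX : CompletelyMetrizable X) (hslh : StronglyLocallyHomogeneous X)
    (U : Set X) (hU : IsOpen U)
    (𝒰 : Set (Set X)) (h𝒰 : ∀ u ∈ 𝒰, IsOpen u ∧ u ⊆ U) (hcov : U ⊆ ⋃₀ 𝒰)
    (A B : Set X) (hAU : A ⊆ U) (hBU : B ⊆ U)
    (hA : SigmaDiscrete A) (hB : SigmaDiscrete B)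
    (hAd : U ⊆ closure A) (hBd : U ⊆ closure B) :
    ∃ h : X ≃ₜ X, ⇑h '' A = B ∧ Near ⇑h id 𝒰 := by
  obtain ⟨m, rfl, hcomplete⟩ := hX
  obtain ⟨ρ, hρ, hρ1, hρ𝒰⟩ := exists_isGauge_ball_subset h𝒰 hcov
  obtain ⟨A', rfl, hA'⟩ := hA
  obtain ⟨B', rfl, hB'⟩ := hB
  set A := ⋃ n, A' n
  set B := ⋃ n, B' n
  have hA'c : ∀ n, (A' n)ᶜ ∈ Filter.codiscrete X := fun n =>
    compl_mem_codiscrete_iff.2 ⟨(hA' n).1, ⟨(hA' n).2⟩⟩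
  have hB'c : ∀ n, (B' n)ᶜ ∈ Filter.codiscrete X := fun n =>
    compl_mem_codiscrete_iff.2 ⟨(hB' n).1, ⟨(hB' n).2⟩⟩
  have hstep : ∀ (n : ℕ) (s : {s // IsPartialMatching U A B s}),
      ∃ s' : {s // IsPartialMatching U A B s}, GaugeClose ρ (1 / 2 / 2 / 2 ^ n) s.1.1 s'.1.1 ∧
        s.1.2 ⊆ s'.1.2 ∧ EqOn s'.1.1 s.1.1 s.1.2 ∧ A' n ⊆ s'.1.2 ∧
        B' n ⊆ ⇑s'.1.1 '' s'.1.2 := by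
    rintro n ⟨s, hs⟩
    have hδ : (0 : ℝ) < 1 / 2 / 2 / 2 ^ n / 2 := by positivity
    obtain ⟨s', hs', hc, hss, heq, hA₀⟩ :=
      hs.exists_extend_source hslh hρ hAU hBd (hA'c n) (subset_iUnion A' n) hδ
    obtain ⟨s'', hs'', hc', hss', heq', hB₀⟩ :=
      hs'.exists_extend_target hslh hρ hBU hAd (hB'c n) (subset_iUnion B' n) hδ
    exact ⟨⟨s'', hs''⟩, add_halves (1 / 2 / 2 / 2 ^ n : ℝ) ▸ hc.trans hc', hss.trans hss',
      fun x hx => (heq' (hss hx)).trans (heq hx), hA₀.trans hss', hB₀⟩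
  choose next hclose hmono heqOn hAnext hBnext using hstep
  let s₀ : {s // IsPartialMatching U A B s} := ⟨(Homeomorph.refl X, ∅),
    ⟨fun _ _ => rfl, by simp, empty_subset _, mapsTo_empty _ _⟩⟩
  let s : ℕ → {s // IsPartialMatching U A B s} := fun n => Nat.rec s₀ next n
  have hs : ∀ n, s (n + 1) = next n (s n) := fun _ => rfl
  have hsclose : ∀ n, GaugeClose ρ (1 / 2 / 2 / 2 ^ n) (s n).1.1 (s (n + 1)).1.1 :=
    fun n => hclose n (s n)
  have hpersist : ∀ n m, n ≤ m → (s n).1.2 ⊆ (s m).1.2 ∧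
      EqOn (s m).1.1 (s n).1.1 (s n).1.2 := by
    intro n m hnm
    induction m, hnm using Nat.le_induction with
    | base => exact ⟨Subset.rfl, fun _ _ => rfl⟩
    | succ m _ ih =>
      exact ⟨ih.1.trans (hmono m (s m)), fun x hx => (heqOn m (s m) (ih.1 hx)).trans (ih.2 hx)⟩
  have hsdist : ∀ n x, dist ((s n).1.1 x) ((s (n + 1)).1.1 x) ≤ ρ x / 2 / 2 / 2 ^ n :=
    fun n x => ((hsclose n).1 x).trans_eq (by ring)
  obtain ⟨f, hf⟩ := exists_homeomorph_tendsto (h := fun n => (s n).1.1) (C := 1 / 2)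
    (fun n x => (hsdist n x).trans (by gcongr; exact hρ1 x)) fun n => (hsclose n).2
  have hfeq : ∀ n, ∀ x ∈ (s n).1.2, f x = (s n).1.1 x := fun n x hx =>
    tendsto_nhds_unique (hf x) <| tendsto_const_nhds.congr' <| by
      filter_upwards [Filter.eventually_ge_atTop n] with m hm
      exact ((hpersist n m hm).2 hx).symm
  refine ⟨f, Subset.antisymm ?_ ?_, fun x hx => ?_⟩
  · rintro _ ⟨a, ha, rfl⟩
    obtain ⟨n, hn⟩ := mem_iUnion.1 ha
    have hmem : a ∈ (s (n + 1)).1.2 := hAnext n (s n) hn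
    rw [hfeq (n + 1) a hmem]
    exact (s (n + 1)).2.mapsTo hmem
  · intro b hb
    obtain ⟨n, hn⟩ := mem_iUnion.1 hb
    obtain ⟨a, ha, rfl⟩ := hBnext n (s n) hn
    exact ⟨a, (s (n + 1)).2.subset ha, hfeq (n + 1) a ha⟩
  · have hdist : dist x (f x) ≤ ρ x / 2 :=
      dist_le_of_le_geometric_two_of_tendsto₀ (f := fun n => (s n).1.1 x)
        (fun n => hsdist n x) (hf x)
    have hpos : 0 < dist x (f x) := dist_pos.2 (Ne.symm hx)
    obtain ⟨u, hu, hxu⟩ := hρ𝒰 x (ρ x / 2) (by linarith) (by linarith)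
    exact ⟨u, hu, hxu (Metric.mem_closedBall'.2 hdist),
      hxu (Metric.mem_closedBall_self (by linarith))⟩

end
end
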